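/- arXiv:math/0103075 — 10 statements merged into one kernel-verified Lean document; each statement's English description precedes it below -/
import Mathlib

section
/- Let A be a (left and right) artinian ring with Jacobson radical r, and let p_1, …, p_n be the (pairwise distinct, finitely many) maximal two-sided ideals of A. Then the inclusions r ⊆ p_i ∩ p_j and r·r ⊆ p_i·p_j induce an isomorphism of A-bimodules r/r² ≅ ⊕_{i,j=1}^{n} (p_i ∩ p_j)/(p_i p_j). -/
/-- A left ideal of a ring is *two-sided* if it is also closed under right multiplication. -/
def Ideal.IsTwoSidedI {A : Type*} [Ring A] (J : Ideal A) : Prop :=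
  ∀ a : A, ∀ x ∈ J, x * a ∈ J

/-- The product of two two-sided ideals (as left ideals): the (left) ideal generated by all
products `a * b` with `a ∈ I`, `b ∈ J`.  For a left ideal `I` this span coincides with the
additive span of such products, i.e. with the usual product ideal `I·J`. -/
def Ideal.prodI {A : Type*} [Ring A] (I J : Ideal A) : Ideal A :=
  Ideal.span {x | ∃ a ∈ I, ∃ b ∈ J, x = a * b}

/-- A *maximal two-sided ideal*: a proper two-sided ideal maximal among proper two-sided
ideals. -/
def Ideal.IsMaximalTwoSided {A : Type*} [Ring A] (J : Ideal A) : Prop :=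
  J.IsTwoSidedI ∧ J ≠ ⊤ ∧ ∀ q : Ideal A, q.IsTwoSidedI → J ≤ q → q = J ∨ q = ⊤

namespace Ideal

variable {A : Type*} [Ring A]

theorem mul_mem_prodI {I J : Ideal A} {a b : A} (ha : a ∈ I) (hb : b ∈ J) :
    a * b ∈ I.prodI J :=
  Ideal.subset_span ⟨a, ha, b, hb, rfl⟩

theorem prodI_mono {I I' J J' : Ideal A} (hI : I ≤ I') (hJ : J ≤ J') :
    I.prodI J ≤ I'.prodI J' := by
  refine Ideal.span_mono ?_
  rintro _ ⟨a, ha, b, hb, rfl⟩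
  exact ⟨a, hI ha, b, hJ hb, rfl⟩

/-- If left multiplication by `u` maps `I` into `K` and right multiplication by `v` maps `J`
into `K`, then `x ↦ u * x * v` maps `I · J` into `K · K`. -/
theorem mul_mul_mem_prodI {I J K : Ideal A} {u v : A}
    (hu : ∀ x ∈ I, u * x ∈ K) (hv : ∀ x ∈ J, x * v ∈ K) {x : A} (hx : x ∈ I.prodI J) :
    u * x * v ∈ K.prodI K := by
  have key : ∀ c : A, u * (c * x) * v ∈ K.prodI K := by
    induction hx using Submodule.span_induction with
    | mem y hy =>
      obtain ⟨a, ha, b, hb, rfl⟩ := hy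
      intro c
      have := mul_mem_prodI (hu _ (I.mul_mem_left c ha)) (hv _ hb)
      simpa only [mul_assoc] using this
    | zero => simp
    | add y z _ _ hy hz =>
      intro c
      simpa only [mul_add, add_mul] using add_mem (hy c) (hz c)
    | smul d y _ hy =>
      intro c
      simpa only [smul_eq_mul, mul_assoc] using hy (c * d)
  simpa using key 1

theorem IsTwoSidedI.sup {I J : Ideal A} (hI : I.IsTwoSidedI) (hJ : J.IsTwoSidedI) :
    (I ⊔ J).IsTwoSidedI := by
  intro a x hx
  obtain ⟨y, hy, z, hz, rfl⟩ := Submodule.mem_sup.1 hx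
  rw [add_mul]
  exact Submodule.add_mem_sup (hI a y hy) (hJ a z hz)

theorem IsMaximalTwoSided.sup_eq_top {I J : Ideal A} (hI : I.IsMaximalTwoSided)
    (hJ : J.IsMaximalTwoSided) (h : I ≠ J) : I ⊔ J = ⊤ := by
  refine (hI.2.2 _ (hI.1.sup hJ.1) le_sup_left).resolve_left fun h' => ?_
  exact (hJ.2.2 I hI.1 (sup_eq_left.1 h')).elim h hI.2.1

/-- The kernel of a surjection onto a simple ring is a maximal two-sided ideal. -/
theorem isMaximalTwoSided_ker {B : Type*} [Ring B] [IsSimpleRing B] (f : A →+* B)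
    (hf : Function.Surjective f) : (RingHom.ker f).IsMaximalTwoSided := by
  refine ⟨fun a x hx => ?_, RingHom.ker_ne_top f, fun q hq hle => ?_⟩
  · rw [RingHom.mem_ker] at hx ⊢
    rw [map_mul, hx, zero_mul]
  · by_cases h : q ≤ RingHom.ker f
    · exact Or.inl (le_antisymm h hle)
    right
    obtain ⟨x, hx, hxf⟩ := SetLike.not_le_iff_exists.1 h
    have hmem : ∀ y, y ∈ q.map f ↔ ∃ z ∈ q, f z = y := fun y =>
      Ideal.mem_map_iff_of_surjective f hf
    have : (q.map f).IsTwoSided := ⟨fun {a} b ha => by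
      obtain ⟨z, hz, rfl⟩ := (hmem _).1 ha
      obtain ⟨c, rfl⟩ := hf b
      exact (hmem _).2 ⟨z * c, hq c z hz, map_mul f z c⟩⟩
    have h1 := IsSimpleRing.one_mem_of_ne_zero_mem (q.map f).toTwoSided hxf
      (Ideal.mem_toTwoSided.2 ((hmem _).2 ⟨x, hx, rfl⟩))
    obtain ⟨z, hz, hz1⟩ := (hmem _).1 (Ideal.mem_toTwoSided.1 h1)
    have hk : 1 - z ∈ q := hle (by rw [RingHom.mem_ker, map_sub, hz1, map_one, sub_self])
    rw [Ideal.eq_top_iff_one]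
    simpa using add_mem hk hz

/-- In an artinian ring, an element lying in all maximal two-sided ideals lies in the
Jacobson radical. -/
theorem mem_jacobson_bot_of_forall_isMaximalTwoSided [IsArtinianRing A] {x : A}
    (hx : ∀ q : Ideal A, q.IsMaximalTwoSided → x ∈ q) : x ∈ (⊥ : Ideal A).jacobson := by
  obtain ⟨n, D, d, _, hd, ⟨e⟩⟩ :=
    IsSemisimpleRing.exists_ringEquiv_pi_matrix_divisionRing (A ⧸ Ring.jacobson A)
  rw [Ideal.jacobson_bot, ← Ideal.Quotient.eq_zero_iff_mem]
  apply e.injective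
  rw [map_zero]
  funext i
  let f := ((Pi.evalRingHom (fun i => Matrix (Fin (d i)) (Fin (d i)) (D i)) i).comp
    (e : _ →+* _)).comp (Ideal.Quotient.mk (Ring.jacobson A))
  have hf : Function.Surjective f :=
    ((Function.surjective_eval i).comp e.surjective).comp Ideal.Quotient.mk_surjective
  exact hx _ (isMaximalTwoSided_ker f hf)

/-- A form of the Chinese remainder theorem for a family of two-sided ideals. -/
theorem exists_one_sub_mem_forall_mem {ι : Type*} {p : ι → Ideal A}
    (hp : ∀ i, (p i).IsTwoSidedI) {i : ι} (s : Finset ι) (hs : ∀ j ∈ s, p i ⊔ p j = ⊤) :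
    ∃ e : A, 1 - e ∈ p i ∧ ∀ j ∈ s, e ∈ p j := by
  classical
  induction s using Finset.induction_on with
  | empty => exact ⟨1, by simp, by simp⟩
  | insert k s _ ih =>
    obtain ⟨e, he, hes⟩ := ih fun j hj => hs j (Finset.mem_insert_of_mem hj)
    obtain ⟨b, hb, a, ha, hab⟩ := Submodule.mem_sup.1
      ((Ideal.eq_top_iff_one _).1 (hs k (Finset.mem_insert_self k s)))
    refine ⟨e * a, ?_, fun j hj => ?_⟩
    · have : 1 - e * a = (1 - e) + e * b := by
        rw [eq_sub_of_add_eq hab]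
        noncomm_ring
      rw [this]
      exact add_mem he ((p i).mul_mem_left e hb)
    · obtain rfl | hj := Finset.mem_insert.1 hj
      · exact (p j).mul_mem_left e ha
      · exact hp j a e (hes j hj)

end Ideal

/-- A family of linear maps that is jointly surjective onto a finite direct sum, with joint
kernel `K`, induces an isomorphism from the quotient by `K`. -/
theorem exists_quotient_equiv_directSum {R M ι : Type*} [Ring R] [AddCommGroup M] [Module R M]
    [Fintype ι] [DecidableEq ι] {N : ι → Type*} [∀ i, AddCommGroup (N i)] [∀ i, Module R (N i)]
    (g : ∀ i, M →ₗ[R] N i) (K : Submodule R M) (hker : ∀ x, (∀ i, g i x = 0) ↔ x ∈ K)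
    (hsurj : ∀ y : ∀ i, N i, ∃ x, ∀ i, g i x = y i) :
    ∃ e : (M ⧸ K) ≃ₗ[R] DirectSum ι N,
      ∀ x, e (Submodule.Quotient.mk x) = ∑ i, DirectSum.lof R ι N i (g i x) := by
  let f : M →ₗ[R] DirectSum ι N := ∑ i, (DirectSum.lof R ι N i).comp (g i)
  have hf : ∀ x, f x = ∑ i, DirectSum.lof R ι N i (g i x) := fun x => by simp [f]
  have hfc : ∀ x i, f x i = g i x := fun x i => by
    rw [hf, DFinsupp.finsetSum_apply, Finset.sum_eq_single i]
    · exact DirectSum.lof_apply R i _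
    · exact fun j _ h => DFinsupp.single_eq_of_ne h.symm
    · simp
  have hK : K = LinearMap.ker f := by
    ext x
    rw [LinearMap.mem_ker, ← hker]
    refine ⟨fun h => DFinsupp.ext fun i => (hfc x i).trans (h i), fun h i => ?_⟩
    rw [← hfc, h]
    rfl
  have hfs : Function.Surjective f := fun y => by
    obtain ⟨x, hx⟩ := hsurj fun i => y i
    exact ⟨x, DFinsupp.ext fun i => (hfc x i).trans (hx i)⟩
  exact ⟨(Submodule.quotEquivOfEq _ _ hK).trans (f.quotKerEquivOfSurjective hfs), hf⟩

open Submodule in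
/-- Let `A` be a (left and right) artinian ring with Jacobson radical `r`
(the intersection of all maximal left ideals, `(⊥ : Ideal A).jacobson`), and let
`p 0, …, p (n-1)` be the pairwise distinct, finitely many maximal two-sided ideals of `A`
(`r ⊆ p i` for each `i`, as the statement presupposes).  Then the inclusions
`r ⊆ p i ∩ p j` and `r·r ⊆ (p i)·(p j)` induce an isomorphism of `A`-bimodules
`r/r² ≅ ⊕_{i,j} (p i ∩ p j)/(p i · p j)`; here the canonical map, which is automatically
`A`-bilinear on both sides, sends the class of `x ∈ r` to the tuple of classes of `x`. -/
theorem jacobson_radical_quotient_iso_directSum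
    (A : Type*) [Ring A] [IsArtinian A A] [IsArtinian Aᵐᵒᵖ Aᵐᵒᵖ]
    (r : Ideal A) (hr : r = (⊥ : Ideal A).jacobson)
    (n : ℕ) (p : Fin n → Ideal A)
    (hmax : ∀ i, (p i).IsMaximalTwoSided)
    (hdistinct : Function.Injective p)
    (hall : ∀ q : Ideal A, q.IsMaximalTwoSided → ∃ i, q = p i)
    (hrp : ∀ i, r ≤ p i) :
    ∃ e : ((↥r) ⧸ (Submodule.comap r.subtype (Ideal.prodI r r) : Submodule A ↥r)) ≃ₗ[A]
        (DirectSum (Fin n × Fin n) fun ij =>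
          ((↥(p ij.1 ⊓ p ij.2)) ⧸
            (Submodule.comap (p ij.1 ⊓ p ij.2 : Ideal A).subtype (Ideal.prodI (p ij.1) (p ij.2)) :
              Submodule A ↥(p ij.1 ⊓ p ij.2)))),
      ∀ x : r, e (Submodule.Quotient.mk x) =
        ∑ ij : Fin n × Fin n,
          DirectSum.lof A (Fin n × Fin n) _ ij
            (Submodule.Quotient.mk
              ⟨(x : A), Submodule.mem_inf.mpr ⟨hrp ij.1 x.2, hrp ij.2 x.2⟩⟩) := by
  have hts := fun i => (hmax i).1
  have hmem : ∀ x, (∀ i, x ∈ p i) → x ∈ r := fun x hx => by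
    rw [hr]
    refine Ideal.mem_jacobson_bot_of_forall_isMaximalTwoSided fun q hq => ?_
    obtain ⟨i, rfl⟩ := hall q hq
    exact hx i
  have hrts : r.IsTwoSidedI := fun a x hx => hmem _ fun i => hts i a x (hrp i hx)
  have hcrt : ∀ i, ∃ e : A, 1 - e ∈ p i ∧ ∀ j ∈ Finset.univ.erase i, e ∈ p j := fun i =>
    Ideal.exists_one_sub_mem_forall_mem hts _ fun j hj =>
      (hmax i).sup_eq_top (hmax j) (hdistinct.ne (Finset.ne_of_mem_erase hj).symm)
  choose e he he' using hcrt
  replace he' : ∀ i j, j ≠ i → e i ∈ p j := fun i j h => he' i j (by simpa using h)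
  have hel : ∀ i, ∀ x ∈ p i, e i * x ∈ r := fun i x hx => hmem _ fun j => by
    by_cases h : j = i
    · subst h; exact (p j).mul_mem_left _ hx
    · exact hts j _ _ (he' i j h)
  have her : ∀ i, ∀ x ∈ p i, x * e i ∈ r := fun i x hx => hmem _ fun j => by
    by_cases h : j = i
    · subst h; exact hts j _ _ hx
    · exact (p j).mul_mem_left _ (he' i j h)
  have hsum : 1 - ∑ i, e i ∈ r := hmem _ fun i => by
    rw [← Finset.add_sum_erase _ _ (Finset.mem_univ i), ← sub_sub]
    exact sub_mem (he i) (sum_mem fun j hj => he' j i (Finset.ne_of_mem_erase hj).symm)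
  let Q : Fin n × Fin n → Type _ := fun ij =>
    (↥(p ij.1 ⊓ p ij.2)) ⧸
      (Submodule.comap (p ij.1 ⊓ p ij.2 : Ideal A).subtype (Ideal.prodI (p ij.1) (p ij.2)) :
        Submodule A ↥(p ij.1 ⊓ p ij.2))
  let g : ∀ ij, r →ₗ[A] Q ij := fun ij =>
    (Submodule.mkQ _).comp (Submodule.inclusion (le_inf (hrp ij.1) (hrp ij.2)))
  have hg : ∀ ij x, g ij x = 0 ↔ (x : A) ∈ Ideal.prodI (p ij.1) (p ij.2) := fun ij x =>
    Submodule.Quotient.mk_eq_zero _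
  have hker : ∀ x : r, (∀ ij, g ij x = 0) ↔ x ∈ Submodule.comap r.subtype (Ideal.prodI r r) := by
    intro x
    rw [Submodule.mem_comap, Submodule.subtype_apply]
    constructor
    · intro hx
      have hx' : ∀ i j, e i * x * e j ∈ Ideal.prodI r r := fun i j =>
        Ideal.mul_mul_mem_prodI (hel i) (her j) ((hg (i, j) x).1 (hx (i, j)))
      have h1 : (∑ i, e i) * x * (∑ j, e j) ∈ Ideal.prodI r r := by
        rw [Finset.sum_mul, Finset.sum_mul_sum]
        exact sum_mem fun i _ => sum_mem fun j _ => hx' i j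
      have h2 := Ideal.mul_mem_prodI hsum (hrts (∑ j, e j) x x.2)
      have h3 := Ideal.mul_mem_prodI x.2 hsum
      have h4 : (x : A) = (∑ i, e i) * x * (∑ j, e j)
          + (1 - ∑ i, e i) * (x * ∑ j, e j) + x * (1 - ∑ i, e i) := by noncomm_ring
      rw [h4]
      exact add_mem (add_mem h1 h2) h3
    · exact fun hx ij => (hg ij x).2 (Ideal.prodI_mono (hrp _) (hrp _) hx)
  have hgsurj : ∀ ij, Function.Surjective (g ij) := by
    rintro ⟨i, j⟩ y
    obtain ⟨⟨y, hyi, hyj⟩, rfl⟩ := Submodule.Quotient.mk_surjective _ y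
    have hz : (1 - e i) * (y * e j) + e i * y ∈ r :=
      add_mem (r.mul_mem_left _ (her j y hyj)) (hel i y hyi)
    refine ⟨⟨_, hz⟩, ((Submodule.Quotient.eq _).2 ?_).symm⟩
    rw [Submodule.mem_comap]
    have h : y - ((1 - e i) * (y * e j) + e i * y) = (1 - e i) * (y * (1 - e j)) := by
      noncomm_ring
    change y - ((1 - e i) * (y * e j) + e i * y) ∈ _
    rw [h]
    exact Ideal.mul_mem_prodI (he i) ((p j).mul_mem_left y (he j))
  have hsurj : ∀ y : ∀ ij, Q ij, ∃ x, ∀ ij, g ij x = y ij := by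
    intro y
    choose x hx using fun ij => hgsurj ij (y ij)
    have hmemr : ∀ ij : Fin n × Fin n, e ij.1 * (x ij) * e ij.2 ∈ r := fun ij =>
      hrts _ _ (r.mul_mem_left _ (x ij).2)
    refine ⟨∑ ij, ⟨_, hmemr ij⟩, fun kl => ?_⟩
    rw [map_sum, Finset.sum_eq_single kl, ← hx kl, ← sub_eq_zero, ← map_sub, hg]
    · have h : e kl.1 * (x kl) * e kl.2 - x kl
          = -((1 - e kl.1) * (x kl * e kl.2) + x kl * (1 - e kl.2)) := by noncomm_ring
      change e kl.1 * (x kl) * e kl.2 - x kl ∈ _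
      rw [h]
      exact neg_mem (add_mem
        (Ideal.mul_mem_prodI (he _) (hts _ _ _ (hrp _ (x kl).2)))
        (Ideal.mul_mem_prodI (hrp _ (x kl).2) (he _)))
    · intro ij _ hne
      rw [hg]
      change e ij.1 * (x ij) * e ij.2 ∈ _
      by_cases h1 : kl.1 = ij.1
      · have h2 : kl.2 ≠ ij.2 := fun h2 => hne (Prod.ext h1 h2).symm
        exact Ideal.mul_mem_prodI ((p kl.1).mul_mem_left _ (hrp _ (x ij).2)) (he' _ _ h2)
      · rw [mul_assoc]
        exact Ideal.mul_mem_prodI (he' _ _ h1) (hts _ _ _ (hrp _ (x ij).2))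
    · simp
  exact exists_quotient_equiv_directSum g _ hker hsurj
end

section
/- Let A be a ring, r a two-sided ideal of A, and e, f idempotents of A such that the two-sided ideals p := A(1−e) + r = (1−e)A + r and q := A(1−f) + r = (1−f)A + r. Then e r f ⊆ p ∩ q, the canonical additive map e r f → (p ∩ q)/(p q), x ↦ x + p q, is surjective, and its kernel is exactly e r² f; consequently (p ∩ q)/(p q) ≅ (e r f)/(e r² f) as additive groups. -/
namespace Ideal

variable {A : Type*} [Ring A]

theorem prodI_mono_s1 {I J K L : Ideal A} (hIK : I ≤ K) (hJL : J ≤ L) :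
    I.prodI J ≤ K.prodI L := by
  refine span_mono ?_
  rintro _ ⟨a, ha, b, hb, rfl⟩
  exact ⟨a, hIK ha, b, hJL hb, rfl⟩

theorem prodI_induction {I J : Ideal A} {P : A → Prop} (mul : ∀ a ∈ I, ∀ b ∈ J, P (a * b))
    (zero : P 0) (add : ∀ x y, P x → P y → P (x + y)) {x : A} (hx : x ∈ I.prodI J) : P x := by
  refine Submodule.closure_induction (p := fun x _ => P x) zero (fun x y _ _ => add x y) ?_ hx
  rintro c _ ⟨a, ha, b, hb, rfl⟩
  rw [smul_eq_mul, ← mul_assoc]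
  exact mul _ (I.mul_mem_left c ha) b hb

theorem IsTwoSidedI.prodI (I : Ideal A) {J : Ideal A} (hJ : J.IsTwoSidedI) :
    (I.prodI J).IsTwoSidedI := by
  intro c x hx
  refine prodI_induction (P := fun x => x * c ∈ I.prodI J) (fun a ha b hb => ?_) ?_ ?_ hx
  · rw [mul_assoc]
    exact mul_mem_prodI ha (hJ c b hb)
  · simp
  · intro x y hx hy
    rw [add_mul]
    exact add_mem hx hy

/-- A corner `e J f` of a two-sided ideal at idempotents consists of the `w ∈ J` fixed by
`w ↦ e w f`. -/
theorem mem_closure_corner_iff {J : Ideal A} (hJ : J.IsTwoSidedI) {e f : A}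
    (he : IsIdempotentElem e) (hf : IsIdempotentElem f) {w : A} :
    w ∈ AddSubgroup.closure {z : A | ∃ x ∈ J, z = e * x * f} ↔ w ∈ J ∧ e * w * f = w := by
  constructor
  · intro hw
    induction hw using AddSubgroup.closure_induction with
    | mem w hw =>
      obtain ⟨x, hx, rfl⟩ := hw
      refine ⟨hJ f _ (J.mul_mem_left e hx), ?_⟩
      rw [← mul_assoc, ← mul_assoc, he.eq, mul_assoc, hf.eq]
    | zero => simp
    | add x y _ _ hx hy => exact ⟨add_mem hx.1 hy.1, by rw [mul_add, add_mul, hx.2, hy.2]⟩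
    | neg x _ hx => exact ⟨neg_mem hx.1, by rw [mul_neg, neg_mul, hx.2]⟩
  · rintro ⟨hw, h⟩
    exact AddSubgroup.subset_closure ⟨w, hw, h.symm⟩

end Ideal

open Submodule in
/-- Let `A` be a ring, `r` a two-sided ideal of `A`, and `e`, `f`
idempotents of `A` such that the two-sided ideals `p := A(1−e) + r = (1−e)A + r` and
`q := A(1−f) + r = (1−f)A + r`.  Then `e r f ⊆ p ∩ q`, the canonical additive map
`e r f → (p ∩ q)/(p q)`, `x ↦ x + p q`, is surjective, and its kernel is exactly `e r² f`;
consequently `(p ∩ q)/(p q) ≅ (e r f)/(e r² f)` as additive groups. -/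
theorem corner_iso_of_idempotents
    (A : Type*) [Ring A] (r : Ideal A) (hr : r.IsTwoSidedI)
    (e f : A) (he : e * e = e) (hf : f * f = f)
    (p q : Ideal A)
    (hpl : p = Ideal.span {1 - e} ⊔ r)
    (hpr : ∀ x : A, x ∈ p ↔ ∃ a : A, ∃ y ∈ r, x = (1 - e) * a + y)
    (hql : q = Ideal.span {1 - f} ⊔ r)
    (hqr : ∀ x : A, x ∈ q ↔ ∃ a : A, ∃ y ∈ r, x = (1 - f) * a + y) :
    (∀ x ∈ r, e * x * f ∈ p ⊓ q) ∧
    (∀ z ∈ p ⊓ q, ∃ x ∈ r, z - e * x * f ∈ Ideal.prodI p q) ∧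
    (∀ x ∈ r, (e * x * f ∈ Ideal.prodI p q ↔
      ∃ y ∈ Ideal.prodI r r, e * x * f = e * y * f)) ∧
    Nonempty
      (((↥(p ⊓ q)) ⧸ (Submodule.comap (p ⊓ q : Ideal A).subtype (Ideal.prodI p q) :
          Submodule A ↥(p ⊓ q))) ≃+
        ((AddSubgroup.closure {z : A | ∃ x ∈ r, z = e * x * f}) ⧸
          ((AddSubgroup.closure {z : A | ∃ y ∈ Ideal.prodI r r, z = e * y * f}).addSubgroupOf
            (AddSubgroup.closure {z : A | ∃ x ∈ r, z = e * x * f})))) := by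
  have he' : IsIdempotentElem e := he
  have hf' : IsIdempotentElem f := hf
  have hrp : r ≤ p := hpl ▸ le_sup_right
  have hrq : r ≤ q := hql ▸ le_sup_right
  have hep : 1 - e ∈ p := hpl ▸ mem_sup_left (Ideal.mem_span_singleton_self _)
  have hfq : 1 - f ∈ q := hql ▸ mem_sup_left (Ideal.mem_span_singleton_self _)
  have e_mul_mem : ∀ z ∈ p, e * z ∈ r := by
    intro z hz
    obtain ⟨a, y, hy, rfl⟩ := (hpr z).1 hz
    rw [mul_add, ← mul_assoc, he'.mul_one_sub_self, zero_mul, zero_add]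
    exact r.mul_mem_left e hy
  have mul_f_mem : ∀ z ∈ q, z * f ∈ r := by
    intro z hz
    rw [hql, mem_sup] at hz
    obtain ⟨u, hu, y, hy, rfl⟩ := hz
    obtain ⟨a, rfl⟩ := Ideal.mem_span_singleton'.1 hu
    rw [add_mul, mul_assoc, hf'.one_sub_mul_self, mul_zero, zero_add]
    exact hr f y hy
  have corner_mem : ∀ x ∈ r, e * x * f ∈ r := fun x hx => hr f _ (r.mul_mem_left e hx)
  have corner_idem : ∀ x : A, e * (e * x * f) * f = e * x * f := by
    intro x
    rw [← mul_assoc, ← mul_assoc, he, mul_assoc, hf]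
  have sub_mem_pq : ∀ z ∈ p ⊓ q, z - e * z * f ∈ Ideal.prodI p q := by
    intro z hz
    have hdecomp : z - e * z * f = (1 - e) * z + e * z * (1 - f) := by noncomm_ring
    rw [hdecomp]
    exact add_mem (Ideal.mul_mem_prodI hep hz.2)
      (Ideal.mul_mem_prodI (p.mul_mem_left e hz.1) hfq)
  have corner_pq : ∀ w ∈ Ideal.prodI p q, e * w * f ∈ Ideal.prodI r r := by
    intro w hw
    refine Ideal.prodI_induction (P := fun w => e * w * f ∈ Ideal.prodI r r)
      (fun a ha b hb => ?_) ?_ ?_ hw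
    · rw [← mul_assoc, mul_assoc]
      exact Ideal.mul_mem_prodI (e_mul_mem a ha) (mul_f_mem b hb)
    · simp
    · intro x y hx hy
      rw [mul_add, add_mul]
      exact add_mem hx hy
  have hrr : (Ideal.prodI r r).IsTwoSidedI := hr.prodI r
  have hrr_le : Ideal.prodI r r ≤ Ideal.prodI p q := Ideal.prodI_mono_s1 hrp hrq
  have corner_sub : ∀ x ∈ r, e * x * f ∈ p ⊓ q := fun x hx =>
    ⟨hrp (corner_mem x hx), hrq (corner_mem x hx)⟩
  have corner_z : ∀ z ∈ p ⊓ q, e * z * f ∈ r := fun z hz => hr f _ (e_mul_mem z hz.1)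
  refine ⟨corner_sub, fun z hz => ⟨e * z * f, corner_z z hz, ?_⟩, fun x _ => ⟨fun h => ?_, ?_⟩, ?_⟩
  · rw [corner_idem]
    exact sub_mem_pq z hz
  · exact ⟨e * x * f, by simpa only [corner_idem] using corner_pq _ h, (corner_idem x).symm⟩
  · rintro ⟨y, hy, h⟩
    rw [h]
    exact hrr_le (hrr f _ (Ideal.mul_mem_left _ e hy))
  · let C := AddSubgroup.closure {z : A | ∃ x ∈ r, z = e * x * f}
    let D := AddSubgroup.closure {z : A | ∃ y ∈ Ideal.prodI r r, z = e * y * f}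
    let N : Submodule A ↥(p ⊓ q) := Submodule.comap (p ⊓ q : Ideal A).subtype (Ideal.prodI p q)
    have hC : C ≤ (p ⊓ q).toAddSubgroup := fun w hw =>
      have hw' := ((Ideal.mem_closure_corner_iff hr he' hf').1 hw).1
      ⟨hrp hw', hrq hw'⟩
    let φ : C →+ (↥(p ⊓ q) ⧸ N) := N.mkQ.toAddMonoidHom.comp (AddSubgroup.inclusion hC)
    have hker : D.addSubgroupOf C = φ.ker := by
      ext ⟨w, hw⟩
      have hφ : φ ⟨w, hw⟩ = 0 ↔ w ∈ Ideal.prodI p q := by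
        change (N.mkQ ⟨w, hC hw⟩ = 0) ↔ _
        rw [Submodule.mkQ_apply, Submodule.Quotient.mk_eq_zero]
        rfl
      have hfix := ((Ideal.mem_closure_corner_iff hr he' hf').1 hw).2
      rw [AddSubgroup.mem_addSubgroupOf, AddMonoidHom.mem_ker, hφ,
        Ideal.mem_closure_corner_iff hrr he' hf']
      exact ⟨fun h => hrr_le h.1, fun h => ⟨by simpa only [hfix] using corner_pq w h, hfix⟩⟩
    have hsurj : Function.Surjective φ := by
      intro z
      obtain ⟨⟨z, hz⟩, rfl⟩ := N.mkQ_surjective z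
      refine ⟨⟨e * z * f, (Ideal.mem_closure_corner_iff hr he' hf').2
        ⟨corner_z z hz, corner_idem z⟩⟩, Eq.symm ?_⟩
      exact (Submodule.Quotient.eq N).2 (sub_mem_pq z hz)
    exact ⟨((QuotientAddGroup.quotientAddEquivOfEq hker).trans
      (QuotientAddGroup.quotientKerEquivOfSurjective φ hsurj)).symm⟩
end

section
/- Let A be a prime left noetherian ring and L a non-torsion left A-module. Then there exist a positive integer r and an injective homomorphism of left A-modules A → L^r. -/
/-- An element of a ring is *regular* if it is neither a left nor a right zero-divisor;
this is Mathlib's `IsRegular`. A left module `L` over a ring `A` is *torsion* if every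
element is annihilated by some regular element of `A`, and *non-torsion* otherwise. -/
def Module.IsNonTorsion (A : Type*) [Ring A] (L : Type*) [AddCommGroup L] [Module A L] : Prop :=
  ¬ ∀ m : L, ∃ a : A, IsRegular a ∧ a • m = 0

/-- A ring `A` is *prime* if `a A b = 0` implies `a = 0` or `b = 0`. -/
def IsPrimeRing' (A : Type*) [Ring A] : Prop :=
  ∀ a b : A, (∀ x : A, a * x * b = 0) → a = 0 ∨ b = 0

/-- A left ideal is *essential* if it meets every nonzero principal left ideal nontrivially. -/
def IsEssentialIdeal {A : Type*} [Ring A] (I : Ideal A) : Prop :=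
  ∀ x : A, x ≠ 0 → ∃ b : A, b * x ≠ 0 ∧ b * x ∈ I

section

variable {A : Type*} [Ring A]

lemma IsEssentialIdeal.mono {I J : Ideal A} (hI : IsEssentialIdeal I) (h : I ≤ J) :
    IsEssentialIdeal J := fun x hx ↦
  let ⟨b, hb, hbI⟩ := hI x hx
  ⟨b, hb, h hbI⟩

lemma mem_torsionOf_self_iff {a x : A} : x ∈ Ideal.torsionOf A A a ↔ x * a = 0 :=
  Iff.rfl

lemma torsionOf_le_torsionOf_mul (a b : A) :
    Ideal.torsionOf A A a ≤ Ideal.torsionOf A A (a * b) := fun x hx ↦ by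
  rw [mem_torsionOf_self_iff] at *
  rw [← mul_assoc, hx, zero_mul]

variable [IsNoetherianRing A]

lemma exists_torsionOf_maximal {S : Set A} (hS : S.Nonempty) :
    ∃ z ∈ S, ∀ y ∈ S, Ideal.torsionOf A A z ≤ Ideal.torsionOf A A y →
      Ideal.torsionOf A A y ≤ Ideal.torsionOf A A z := by
  obtain ⟨_, ⟨z, hz, rfl⟩, hmax⟩ := set_has_maximal_iff_noetherian.mpr
    (inferInstance : IsNoetherian A A) (Ideal.torsionOf A A '' S) (hS.image _)
  exact ⟨z, hz, fun y hy hle ↦ by_contra fun h ↦ hmax _ ⟨y, hy, rfl⟩ (lt_of_le_not_ge hle h)⟩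

/-- A prime left noetherian ring is left nonsingular. -/
lemma IsPrimeRing'.eq_zero_of_isEssentialIdeal_torsionOf (hA : IsPrimeRing' A) {z : A}
    (hz : IsEssentialIdeal (Ideal.torsionOf A A z)) : z = 0 := by
  by_contra hz0
  obtain ⟨z, ⟨hz0, hz⟩, hmax⟩ := exists_torsionOf_maximal
    (S := {z : A | z ≠ 0 ∧ IsEssentialIdeal (Ideal.torsionOf A A z)}) ⟨z, hz0, hz⟩
  refine hz0 (or_self_iff.mp (hA z z fun a ↦ by_contra fun h ↦ ?_))
  obtain ⟨b, hb, hbz⟩ := hz (z * a) (left_ne_zero_of_mul h)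
  have hle : Ideal.torsionOf A A z ≤ Ideal.torsionOf A A (z * a * z) := by
    rw [mul_assoc]
    exact torsionOf_le_torsionOf_mul _ _
  have hbz' : b * z = 0 := hmax _ ⟨h, hz.mono hle⟩ hle (by
    rw [mem_torsionOf_self_iff] at *
    rw [← mul_assoc, hbz])
  exact hb (by rw [← mul_assoc, hbz', zero_mul])

/-- A nonzero left ideal of a prime left noetherian ring is not nil. -/
lemma IsPrimeRing'.exists_not_isNilpotent (hA : IsPrimeRing' A) {J : Ideal A} (hJ : J ≠ ⊥) :
    ∃ a ∈ J, ¬ IsNilpotent a := by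
  by_contra! hnil
  obtain ⟨x, hxJ, hx⟩ := J.ne_bot_iff.mp hJ
  have hxA (a : A) : IsNilpotent (x * a) := by
    obtain ⟨n, hn⟩ := hnil (a * x) (J.mul_mem_left a hxJ)
    refine ⟨n + 1, ?_⟩
    have h : ∀ n : ℕ, (x * a) ^ (n + 1) = x * (a * x) ^ n * a := fun n ↦ by
      induction n with
      | zero => simp
      | succ n ih => rw [pow_succ, ih, pow_succ (a * x)]; simp only [mul_assoc]
    rw [h, hn, mul_zero, zero_mul]
  obtain ⟨z, ⟨hz0, c, rfl⟩, hmax⟩ := exists_torsionOf_maximal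
    (S := {z : A | z ≠ 0 ∧ ∃ c, z = x * c}) ⟨x, hx, 1, by simp⟩
  refine hz0 (or_self_iff.mp (hA _ _ fun b ↦ ?_))
  have hzb : IsNilpotent (x * c * b) := by
    rw [mul_assoc]
    exact hxA _
  obtain ⟨k, hk, hk'⟩ : ∃ k, (x * c * b) ^ (k + 1) = 0 ∧ (x * c * b) ^ k ≠ 0 := by
    by_contra! h
    obtain ⟨n, hn⟩ := hzb
    induction n with
    | zero => exact hz0 (by rw [← mul_one (x * c), ← pow_zero, hn, mul_zero])
    | succ n ih => exact ih (h n hn)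
  obtain _ | k := k
  · rw [zero_add, pow_one] at hk
    rw [hk, zero_mul]
  · have hpow : (x * c * b) ^ (k + 1) = x * c * (b * (x * c * b) ^ k) := by
      rw [pow_succ', mul_assoc]
    refine hmax _ ⟨hk', c * (b * (x * c * b) ^ k), by rw [hpow, mul_assoc]⟩ ?_ ?_
    · rw [hpow]
      exact torsionOf_le_torsionOf_mul _ _
    · exact (pow_succ' (x * c * b) (k + 1)).symm.trans hk

lemma IsPrimeRing'.exists_mul_mul_self_eq_zero_imp (hA : IsPrimeRing' A) {J : Ideal A}
    (hJ : J ≠ ⊥) : ∃ a ∈ J, a ≠ 0 ∧ ∀ x : A, x * a * a = 0 → x * a = 0 := by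
  obtain ⟨b, hbJ, hb⟩ := hA.exists_not_isNilpotent hJ
  have hpow (n : ℕ) : b ^ n ≠ 0 := fun h ↦ hb ⟨n, h⟩
  obtain ⟨_, ⟨n, rfl⟩, hmax⟩ := exists_torsionOf_maximal
    (S := Set.range fun n : ℕ ↦ b ^ (n + 1)) ⟨_, 0, rfl⟩
  refine ⟨b ^ (n + 1), ?_, hpow _, fun x hx ↦ hmax (b ^ (n + 1) * b ^ (n + 1))
    ⟨n + 1 + n, ?_⟩ (torsionOf_le_torsionOf_mul _ _) ?_⟩
  · rw [pow_succ]
    exact J.mul_mem_left _ hbJ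
  · simp only [← pow_add]
    rfl
  · rwa [mem_torsionOf_self_iff, ← mul_assoc]

lemma IsEssentialIdeal.exists_mul_right_eq_zero_imp {I : Ideal A} (hI : IsEssentialIdeal I)
    (hA : IsPrimeRing' A) : ∃ c ∈ I, ∀ x : A, x * c = 0 → x = 0 := by
  obtain ⟨V, ⟨c, hcI, hcc, hV⟩, hmax⟩ := set_has_maximal_iff_noetherian.mpr
    (inferInstance : IsNoetherian A A)
    {V : Ideal A | ∃ c ∈ I, (∀ x, x * c * c = 0 → x * c = 0) ∧ ∀ v ∈ V, v * c = 0 → v = 0}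
    ⟨⊥, 0, I.zero_mem, by simp, by simp⟩
  by_cases hJ : Ideal.torsionOf A A c ⊓ I = ⊥
  · refine ⟨c, hcI, fun x hx ↦ by_contra fun hx0 ↦ ?_⟩
    obtain ⟨b, hb, hbI⟩ := hI x hx0
    exact hb ((Submodule.eq_bot_iff _).mp hJ _
      ⟨by rw [SetLike.mem_coe, mem_torsionOf_self_iff, mul_assoc, hx, mul_zero], hbI⟩)
  obtain ⟨a, ⟨hac, haI⟩, ha0, haa⟩ := hA.exists_mul_mul_self_eq_zero_imp hJ
  replace hac : a * c = 0 := hac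
  have hdirect (x y : A) (h : x * c + y * a = 0) : x * c = 0 ∧ y * a = 0 := by
    have hxc : x * c = 0 := hcc x (by simpa [add_mul, mul_assoc y, hac] using congr($h * c))
    exact ⟨hxc, by rwa [hxc, zero_add] at h⟩
  refine (hmax (V ⊔ Ideal.span {a}) ⟨c + a, I.add_mem hcI haI, fun x hx ↦ ?_, fun x hx hxc ↦ ?_⟩
    (left_lt_sup.mpr fun h ↦ ha0 (hV a (h (Ideal.mem_span_singleton_self a)) hac))).elim
  · obtain ⟨h1, h2⟩ := hdirect _ _ (by rwa [mul_add] at hx)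
    have hxc : x * c = 0 := hcc x (by simpa [mul_add, add_mul, mul_assoc x a c, hac] using h1)
    rw [mul_add, hxc, zero_add] at h2 ⊢
    exact haa x h2
  · obtain ⟨hc, ha⟩ := hdirect x x (by rwa [mul_add] at hxc)
    obtain ⟨v, hv, w, hw, rfl⟩ := Submodule.mem_sup.mp hx
    obtain ⟨y, rfl⟩ := Ideal.mem_span_singleton'.mp hw
    have hv0 : v = 0 := hV v hv (by simpa [add_mul, mul_assoc y, hac] using hc)
    rw [hv0, zero_add] at ha ⊢
    exact haa y ha

lemma isEssentialIdeal_span_singleton {c : A} (hc : ∀ x : A, x * c = 0 → x = 0) :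
    IsEssentialIdeal (Ideal.span {c}) := by
  intro x hx
  by_contra! h
  let f : A × Ideal.span {x} →ₗ[A] A :=
    (LinearMap.toSpanSingleton A A c).coprod (Submodule.subtype _)
  have hf : Function.Injective f := by
    refine (injective_iff_map_eq_zero f).mpr fun ⟨a, k, hk⟩ hak ↦ ?_
    obtain ⟨b, rfl⟩ := Ideal.mem_span_singleton'.mp hk
    replace hak : a * c + b * x = 0 := hak
    have hb : b * x = 0 := by
      by_contra hb
      exact h b hb (Ideal.mem_span_singleton'.mpr
        ⟨-a, by rw [neg_mul]; exact (eq_neg_of_add_eq_zero_right hak).symm⟩)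
    have ha : a = 0 := hc a (by rwa [hb, add_zero] at hak)
    simp [ha, hb]
  have := IsNoetherian.subsingleton_of_prod_injective f hf
  exact hx (congrArg Subtype.val
    (Subsingleton.elim (⟨x, Ideal.mem_span_singleton_self x⟩ : Ideal.span {x}) 0))

/-- **Goldie**: an essential left ideal of a prime left noetherian ring contains a regular
element. -/
lemma IsEssentialIdeal.exists_isRegular {I : Ideal A} (hI : IsEssentialIdeal I)
    (hA : IsPrimeRing' A) : ∃ c ∈ I, IsRegular c := by
  obtain ⟨c, hcI, hc⟩ := hI.exists_mul_right_eq_zero_imp hA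
  refine ⟨c, hcI, isLeftRegular_iff_right_eq_zero_of_mul.mpr fun y hy ↦ ?_,
    isRightRegular_iff_left_eq_zero_of_mul.mpr hc⟩
  refine hA.eq_zero_of_isEssentialIdeal_torsionOf ((isEssentialIdeal_span_singleton hc).mono ?_)
  rwa [Ideal.span_singleton_le_iff_mem, mem_torsionOf_self_iff]

/-- A nonzero left ideal of a prime left noetherian ring has a finite subset whose left annihilator
vanishes. -/
lemma IsPrimeRing'.exists_finset_forall_mul_eq_zero (hA : IsPrimeRing' A) (K : Ideal A)
    (hK : K ≠ ⊥) :
    ∃ s : Finset A, (∀ k ∈ s, k ∈ K) ∧ ∀ a : A, (∀ k ∈ s, a * k = 0) → a = 0 := by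
  classical
  obtain ⟨V, ⟨s, hsK, hV⟩, hmax⟩ := set_has_maximal_iff_noetherian.mpr
    (inferInstance : IsNoetherian A A)
    {V : Ideal A | ∃ s : Finset A, (∀ k ∈ s, k ∈ K) ∧ ∀ v ∈ V, (∀ k ∈ s, v * k = 0) → v = 0}
    ⟨⊥, ∅, by simp, by simp⟩
  refine ⟨s, hsK, fun j hj ↦ by_contra fun hj0 ↦ ?_⟩
  obtain ⟨k, hkK, hk⟩ : ∃ k ∈ K, j * k ≠ 0 := by
    by_contra! h
    obtain ⟨x, hxK, hx⟩ := K.ne_bot_iff.mp hK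
    exact (hA j x fun a ↦ by rw [mul_assoc]; exact h _ (K.mul_mem_left a hxK)).elim hj0 hx
  have hess : ¬ IsEssentialIdeal (Ideal.torsionOf A A (j * k)) :=
    fun h ↦ hk (hA.eq_zero_of_isEssentialIdeal_torsionOf h)
  simp only [IsEssentialIdeal, not_forall, not_exists, not_and] at hess
  obtain ⟨w, hw, hwjk⟩ := hess
  have hU (b : A) (h : b * (w * j) * k = 0) : b * w = 0 := by
    by_contra hb
    exact hwjk b hb (by rw [mem_torsionOf_self_iff, ← h]; simp only [mul_assoc])
  have hwj : w * j ≠ 0 := fun h ↦ hw (by simpa using hU 1 (by rw [h, mul_zero, zero_mul]))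
  have hUs (b : A) : ∀ l ∈ s, b * (w * j) * l = 0 := fun l hl ↦ by
    rw [mul_assoc, mul_assoc w, hj l hl, mul_zero, mul_zero]
  refine hmax (V ⊔ Ideal.span {w * j}) ⟨insert k s, by simpa [hkK] using hsK, fun x hx hxs ↦ ?_⟩
    (left_lt_sup.mpr fun h ↦ hwj (hV _ (h (Ideal.mem_span_singleton_self _))
      (by simpa using hUs 1)))
  obtain ⟨v, hv, u, hu, rfl⟩ := Submodule.mem_sup.mp hx
  obtain ⟨b, rfl⟩ := Ideal.mem_span_singleton'.mp hu
  have hv0 : v = 0 := hV v hv fun l hl ↦ by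
    simpa [add_mul, hUs b l hl] using hxs l (Finset.mem_insert_of_mem hl)
  have hbw : b * w = 0 := hU b (by simpa [hv0] using hxs k (Finset.mem_insert_self _ _))
  rw [hv0, zero_add, ← mul_assoc, hbw, zero_mul]

end

/-- Let `A` be a prime left noetherian ring and `L` a non-torsion left
`A`-module. Then there exist a positive integer `r` and an injective homomorphism of left
`A`-modules `A → L^r`. -/
theorem prime_noetherian_embeds_in_power_of_nontorsion
    (A : Type*) [Ring A] [IsNoetherianRing A] (hA : IsPrimeRing' A)
    (L : Type*) [AddCommGroup L] [Module A L] (hL : Module.IsNonTorsion A L) :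
    ∃ (r : ℕ), 0 < r ∧ ∃ f : A →ₗ[A] (Fin r → L), Function.Injective f := by
  obtain ⟨m, hm⟩ := not_forall.mp hL
  have hess : ¬ IsEssentialIdeal (Ideal.torsionOf A L m) := fun h ↦ by
    obtain ⟨c, hc, hreg⟩ := h.exists_isRegular hA
    exact hm ⟨c, hreg, hc⟩
  simp only [IsEssentialIdeal, not_forall, not_exists, not_and] at hess
  obtain ⟨x, hx, hxm⟩ := hess
  obtain ⟨s, hs, hs0⟩ := hA.exists_finset_forall_mul_eq_zero (Ideal.span {x}) (by simpa using hx)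
  have hinj : ∀ a : A, (∀ k ∈ s, (a * k) • m = 0) → a = 0 := fun a ha ↦ hs0 a fun k hk ↦ by
    obtain ⟨b, hb⟩ := Ideal.mem_span_singleton'.mp (hs k hk)
    by_contra h
    refine hxm (a * b) ?_ ?_
    · rwa [mul_assoc, hb]
    · rw [mul_assoc, hb]
      exact ha k hk
  obtain rfl | hne := s.eq_empty_or_nonempty
  · exact ⟨1, one_pos, 0, (injective_iff_map_eq_zero _).mpr fun a _ ↦ hinj a (by simp)⟩
  · refine ⟨s.card, hne.card_pos,
      LinearMap.pi fun i ↦ LinearMap.toSpanSingleton A L ((s.equivFin.symm i : A) • m),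
      (injective_iff_map_eq_zero _).mpr fun a ha ↦ hinj a fun k hk ↦ ?_⟩
    simpa [mul_smul] using congrFun ha (s.equivFin ⟨k, hk⟩)
end

section
/- Let A be a prime left noetherian ring and let dim be an exact dimension function on left A-modules. If L is a non-torsion left A-module, then dim L = dim A (where A is regarded as a left module over itself). -/
universe v

/-- A left ideal `I` is *essential* if it meets every nonzero left ideal nontrivially. -/
def Ideal.IsEssential {A : Type*} [Ring A] (I : Ideal A) : Prop :=
  ∀ k : A, k ≠ 0 → ∃ w : A, w * k ≠ 0 ∧ w * k ∈ I

section Goldie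

variable {A : Type*} [Ring A]

/-- Among the elements with a given property, some element has maximal left annihilator. -/
lemma exists_maximal_left_annihilator [IsNoetherianRing A] (p : A → Prop) (hp : ∃ z, p z) :
    ∃ z, p z ∧ ∀ y, p y → (∀ x, x * z = 0 → x * y = 0) → ∀ x, x * y = 0 → x * z = 0 := by
  obtain ⟨z₀, hz₀⟩ := hp
  obtain ⟨-, ⟨z, hz, rfl⟩, hmax⟩ := set_has_maximal_iff_noetherian.mpr
    (inferInstance : IsNoetherian A A) (Ideal.torsionOf A A '' {z | p z}) ⟨_, z₀, hz₀, rfl⟩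
  refine ⟨z, hz, fun y hy hzy x hx => ?_⟩
  by_contra hxz
  exact hmax _ ⟨y, hy, rfl⟩ (lt_of_le_not_ge hzy fun h => hxz (h hx))

/-- In a prime left noetherian ring, the left annihilator of a nonzero element is not essential. -/
lemma eq_zero_of_isEssential_torsionOf [IsNoetherianRing A] (hA : IsPrimeRing' A) {z : A}
    (hz : (Ideal.torsionOf A A z).IsEssential) : z = 0 := by
  by_contra hz0
  obtain ⟨z, ⟨hz, hz0⟩, hmax⟩ := exists_maximal_left_annihilator
    (fun z : A => (Ideal.torsionOf A A z).IsEssential ∧ z ≠ 0) ⟨z, hz, hz0⟩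
  refine hz0 (or_self_iff.mp (hA z z fun y => ?_))
  by_contra hzyz
  have hle : ∀ x, x * z = 0 → x * (z * y * z) = 0 := fun x hx => by
    rw [← mul_assoc, ← mul_assoc, hx, zero_mul, zero_mul]
  have hess : (Ideal.torsionOf A A (z * y * z)).IsEssential := fun k hk => by
    obtain ⟨w, hw, hwk⟩ := hz k hk
    exact ⟨w, hw, hle _ hwk⟩
  obtain ⟨w, hw, hwz⟩ := hz (z * y) (left_ne_zero_of_mul hzyz)
  have h := hmax _ ⟨hess, hzyz⟩ hle w (by rw [← mul_assoc]; exact hwz)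
  exact hw (by rw [← mul_assoc, h, zero_mul])

/-- A nonzero left ideal of a prime left noetherian ring is not nil. -/
lemma exists_mem_not_isNilpotent [IsNoetherianRing A] (hA : IsPrimeRing' A) {J : Ideal A}
    (hJ : J ≠ ⊥) : ∃ b ∈ J, ¬ IsNilpotent b := by
  by_contra! hnil
  obtain ⟨a, haJ, ha0⟩ := J.ne_bot_iff.mp hJ
  have hnil_right : ∀ y, IsNilpotent (a * y) := fun y => by
    obtain ⟨n, hn⟩ := hnil (y * a) (J.mul_mem_left y haJ)
    refine ⟨n + 1, ?_⟩
    have h : (a * y) ^ (n + 1) = a * (y * a) ^ n * y := by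
      rw [pow_succ, ← mul_assoc, mul_pow_mul]
    rw [h, hn, mul_zero, zero_mul]
  obtain ⟨b, ⟨⟨c, rfl⟩, hb0⟩, hmax⟩ := exists_maximal_left_annihilator
    (fun b : A => (∃ c, b = a * c) ∧ b ≠ 0) ⟨a, ⟨1, (mul_one a).symm⟩, ha0⟩
  refine hb0 (or_self_iff.mp (hA _ _ fun x => ?_))
  rcases eq_or_ne (a * c * x) 0 with h0 | h0
  · rw [h0, zero_mul]
  obtain ⟨n, hn0, hn⟩ : ∃ n, (a * c * x) ^ (n + 1) ≠ 0 ∧ (a * c * x) ^ (n + 2) = 0 := by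
    have hx : IsNilpotent (a * c * x) := by rw [mul_assoc]; exact hnil_right _
    classical
    have hspec := Nat.find_spec hx
    have hmin := fun m => Nat.find_min hx (m := m)
    revert hspec hmin
    rcases Nat.find hx with _ | _ | m
    · exact fun h _ => absurd (by rw [← mul_one (a * c * x), ← pow_zero (a * c * x), h, mul_zero]) h0
    · exact fun h _ => absurd (by simpa using h) h0
    · exact fun h hmin => ⟨m, hmin _ (Nat.lt_succ_self _), h⟩
  refine hmax _ ⟨⟨c * x * (a * c * x) ^ n, ?_⟩, hn0⟩ (fun y hy => ?_) _ ?_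
  · rw [pow_succ']; simp only [mul_assoc]
  · rw [pow_succ', ← mul_assoc, ← mul_assoc, hy, zero_mul, zero_mul]
  · rw [← pow_succ', hn]

/-- A nonzero left ideal of a prime left noetherian ring contains a nonzero element whose
left annihilator agrees with that of its square. -/
lemma exists_mem_mul_self_cancel [IsNoetherianRing A] (hA : IsPrimeRing' A) {J : Ideal A}
    (hJ : J ≠ ⊥) : ∃ a ∈ J, a ≠ 0 ∧ ∀ y, y * a * a = 0 → y * a = 0 := by
  obtain ⟨b, hbJ, hb⟩ := exists_mem_not_isNilpotent hA hJ
  have hmono : Monotone fun n => Ideal.torsionOf A A (b ^ n) :=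
    monotone_nat_of_le_succ fun n x (hx : x * b ^ n = 0) => by
      change x * b ^ (n + 1) = 0
      rw [pow_succ, ← mul_assoc, hx, zero_mul]
  obtain ⟨N, hN⟩ := monotone_stabilizes_iff_noetherian.mpr (inferInstance : IsNoetherian A A)
    ⟨_, hmono⟩
  refine ⟨b ^ (N + 1), ?_, fun h => hb ⟨_, h⟩, fun y hy => ?_⟩
  · rw [pow_succ]; exact J.mul_mem_left _ hbJ
  · have hmem : y ∈ Ideal.torsionOf A A (b ^ (N + 1 + (N + 1))) := by
      change y * b ^ (N + 1 + (N + 1)) = 0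
      rw [pow_add, ← mul_assoc, hy]
    exact hmono N.le_succ ((hN _ (by omega)).ge hmem)

/-- An essential left ideal of a prime left noetherian ring contains an element whose left
annihilator vanishes. -/
lemma Ideal.IsEssential.exists_mem_left_annihilator_eq_zero [IsNoetherianRing A]
    (hA : IsPrimeRing' A) {I : Ideal A} (hI : I.IsEssential) :
    ∃ c ∈ I, ∀ x, x * c = 0 → x = 0 := by
  obtain ⟨N, ⟨hNI, c, hcN, hc⟩, hmax⟩ := set_has_maximal_iff_noetherian.mpr
    (inferInstance : IsNoetherian A A)
    {N : Ideal A | N ≤ I ∧ ∃ c ∈ N, ∀ x ∈ N, x * c = 0 → x = 0}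
    ⟨⊥, bot_le, 0, zero_mem _, fun x hx _ => hx⟩
  refine ⟨c, hNI hcN, fun x hx => ?_⟩
  by_contra hx0
  obtain ⟨w, hw0, hwI⟩ := hI x hx0
  have hJ : Ideal.torsionOf A A c ⊓ I ≠ ⊥ := by
    refine (Submodule.ne_bot_iff _).mpr ⟨w * x, ⟨?_, hwI⟩, hw0⟩
    change w * x * c = 0
    rw [mul_assoc, hx, mul_zero]
  obtain ⟨a, ⟨hac : a * c = 0, haI⟩, ha0, ha⟩ := exists_mem_mul_self_cancel hA hJ
  have haN : a ∉ N := fun h => ha0 (hc a h hac)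
  have hspan : a ∈ N ⊔ Ideal.span {a} :=
    (le_sup_right : _ ≤ N ⊔ Ideal.span {a}) (Ideal.mem_span_singleton_self a)
  refine hmax (N ⊔ Ideal.span {a}) ⟨sup_le hNI ((Ideal.span_singleton_le_iff_mem I).mpr haI),
    c + a, add_mem ((le_sup_left : N ≤ _) hcN) hspan, fun x hx hxca => ?_⟩
    (lt_of_le_not_ge le_sup_left fun h => haN (h hspan))
  have hxc : x * c = 0 := by
    refine hc _ (N.smul_mem x hcN) ?_
    have h : x * (c + a) * c = x * c * c + x * (a * c) := by noncomm_ring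
    rwa [hxca, zero_mul, hac, mul_zero, add_zero, eq_comm] at h
  have hxa : x * a = 0 := by rwa [mul_add, hxc, zero_add] at hxca
  obtain ⟨n, hn, u, hu, rfl⟩ := Submodule.mem_sup.mp hx
  obtain ⟨y, rfl⟩ := Ideal.mem_span_singleton'.mp hu
  have hn0 : n = 0 := hc n hn (by rwa [add_mul, mul_assoc, hac, mul_zero, add_zero] at hxc)
  subst hn0
  rw [zero_add] at hxa ⊢
  exact ha y hxa

/-- In a left noetherian ring, an element with vanishing left annihilator generates an essential
left ideal. -/
lemma isEssential_span_singleton [IsNoetherianRing A] {c : A} (hc : ∀ x, x * c = 0 → x = 0) :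
    (Ideal.span {c}).IsEssential := by
  intro k hk
  by_contra! hdisj
  let f : A × Ideal.span {k} →ₗ[A] A :=
    (LinearMap.toSpanSingleton A A c).coprod (Ideal.span {k}).subtype
  have hf : Function.Injective f := by
    refine (injective_iff_map_eq_zero f).mpr ?_
    rintro ⟨x, u, hu⟩ (h : x * c + u = 0)
    obtain ⟨w, rfl⟩ := Ideal.mem_span_singleton'.mp hu
    have hw : w * k = 0 := by
      by_contra hw
      refine hdisj w hw (Ideal.mem_span_singleton'.mpr ⟨-x, ?_⟩)
      rw [neg_mul, neg_eq_of_add_eq_zero_right h]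
    have hx : x = 0 := hc x (by rwa [hw, add_zero] at h)
    subst hx
    simp [hw]
  have := IsNoetherian.subsingleton_of_prod_injective f hf
  exact hk (congrArg Subtype.val (Subsingleton.elim
    (⟨k, Ideal.mem_span_singleton_self k⟩ : Ideal.span {k}) 0))

/-- **Goldie**: an essential left ideal of a prime left noetherian ring contains a regular
element. -/
theorem Ideal.IsEssential.exists_mem_isRegular [IsNoetherianRing A] (hA : IsPrimeRing' A)
    {I : Ideal A} (hI : I.IsEssential) : ∃ c ∈ I, IsRegular c := by
  obtain ⟨c, hcI, hc⟩ := hI.exists_mem_left_annihilator_eq_zero hA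
  refine ⟨c, hcI, isLeftRegular_of_non_zero_divisor c fun x hx => ?_,
    isRightRegular_of_non_zero_divisor c hc⟩
  refine eq_zero_of_isEssential_torsionOf hA fun k hk => ?_
  obtain ⟨w, hw, hwc⟩ := isEssential_span_singleton hc k hk
  obtain ⟨y, hy⟩ := Ideal.mem_span_singleton'.mp hwc
  refine ⟨w, hw, ?_⟩
  change w * k * x = 0
  rw [← hy, mul_assoc, hx, mul_zero]

end Goldie

/-- Exact dimension functions on left `A`-modules. -/
structure IsExactDimension {A : Type v} [Ring A]
    (dim : (M : Type v) → [AddCommGroup M] → [Module A M] → WithBot (WithTop ℤ)) : Prop where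
  congr : ∀ (M N : Type v) [AddCommGroup M] [Module A M] [AddCommGroup N] [Module A N],
    Nonempty (M ≃ₗ[A] N) → dim M = dim N
  exact : ∀ (M : Type v) [AddCommGroup M] [Module A M] (N : Submodule A M),
    dim M = max (dim N) (dim (M ⧸ N))
  directed : ∀ (M : Type v) [AddCommGroup M] [Module A M] (ι : Type v)
    (N : ι → Submodule A M), Directed (· ≤ ·) N → iSup N = ⊤ → dim M = ⨆ i, dim (N i)

namespace IsExactDimension

variable {A : Type v} [Ring A]
  {dim : (M : Type v) → [AddCommGroup M] → [Module A M] → WithBot (WithTop ℤ)}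
  {M N : Type v} [AddCommGroup M] [Module A M] [AddCommGroup N] [Module A N]

lemma le_of_injective (h : IsExactDimension dim) (f : M →ₗ[A] N) (hf : Function.Injective f) :
    dim M ≤ dim N := by
  rw [h.congr M (LinearMap.range f) ⟨LinearEquiv.ofInjective f hf⟩, h.exact N (LinearMap.range f)]
  exact le_max_left _ _

lemma le_of_surjective (h : IsExactDimension dim) (f : M →ₗ[A] N) (hf : Function.Surjective f) :
    dim N ≤ dim M := by
  rw [← h.congr (M ⧸ LinearMap.ker f) N ⟨f.quotKerEquivOfSurjective hf⟩,
    h.exact M (LinearMap.ker f)]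
  exact le_max_right _ _

lemma sup_le (h : IsExactDimension dim) {d : WithBot (WithTop ℤ)} {P Q : Submodule A M}
    (hP : dim P ≤ d) (hQ : dim Q ≤ d) : dim ↥(P ⊔ Q) ≤ d := by
  rw [h.exact ↥(P ⊔ Q) (P.comap (P ⊔ Q).subtype)]
  refine max_le ?_ ?_
  · rwa [h.congr _ P ⟨Submodule.comapSubtypeEquivOfLe le_sup_left⟩]
  · refine (h.le_of_surjective
      ((Submodule.mkQ _).comp (Submodule.inclusion (le_sup_right : Q ≤ P ⊔ Q))) ?_).trans hQ
    intro x
    obtain ⟨⟨x, hx⟩, rfl⟩ := Submodule.mkQ_surjective _ x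
    obtain ⟨p, hp, q, hq, rfl⟩ := Submodule.mem_sup.mp hx
    refine ⟨⟨q, hq⟩, ((Submodule.Quotient.eq _).mpr ?_).symm⟩
    change p + q - q ∈ P
    rwa [add_sub_cancel_right]

lemma span_singleton_le (h : IsExactDimension dim) (x : M) :
    dim (Submodule.span A {x}) ≤ dim A := by
  rw [← h.congr _ _ ⟨LinearEquiv.ofEq _ _ (LinearMap.range_toSpanSingleton (R := A) x)⟩]
  exact h.le_of_surjective _ (LinearMap.surjective_rangeRestrict _)

/-- The ring has the largest dimension among all of its modules. -/
lemma le_dim_ring (h : IsExactDimension dim) (M : Type v) [AddCommGroup M] [Module A M] :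
    dim M ≤ dim A := by
  rw [h.directed M {P : Submodule A M // P.FG} Subtype.val]
  · exact iSup_le fun ⟨P, hP⟩ => Submodule.fg_induction
      (motive := fun P _ => dim P ≤ dim A) h.span_singleton_le (fun _ _ _ _ => h.sup_le) P hP
  · exact fun P Q => ⟨⟨P.1 ⊔ Q.1, P.2.sup Q.2⟩, le_sup_left, le_sup_right⟩
  · refine eq_top_iff.mpr fun x _ => ?_
    exact le_iSup (fun P : {P : Submodule A M // P.FG} => P.1)
      ⟨Submodule.span A {x}, Submodule.fg_span_singleton x⟩ (Submodule.mem_span_singleton_self x)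

/-- Nonzero left ideals of a prime left noetherian ring have the dimension of the ring. -/
lemma dim_ring_le_of_ne_bot [IsNoetherianRing A] (h : IsExactDimension dim) (hA : IsPrimeRing' A)
    {J : Ideal A} (hJ : J ≠ ⊥) : dim A ≤ dim J := by
  obtain ⟨N, hN, hmax⟩ := set_has_maximal_iff_noetherian.mpr
    (inferInstance : IsNoetherian A A) {N : Ideal A | dim N ≤ dim J} ⟨J, le_refl (dim J)⟩
  have hle : ∀ P : Ideal A, dim P ≤ dim J → P ≤ N := fun P hP => by
    by_contra hPN
    exact hmax (N ⊔ P) (h.sup_le hN hP) (left_lt_sup.mpr hPN)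
  have hmul : ∀ j ∈ J, ∀ a, j * a ∈ N := fun j hj a =>
    hle (Submodule.map (LinearMap.toSpanSingleton A A a) J)
      (h.le_of_surjective _
        (LinearMap.submoduleMap_surjective (LinearMap.toSpanSingleton A A a) J))
      (Submodule.mem_map_of_mem hj)
  have hess : Ideal.IsEssential N := fun k hk => by
    obtain ⟨j, hj, hj0⟩ := J.ne_bot_iff.mp hJ
    obtain ⟨x, hx⟩ : ∃ x, j * x * k ≠ 0 := by
      by_contra! hx
      exact (hA j k hx).elim hj0 hk
    exact ⟨j * x, hx, by rw [mul_assoc]; exact hmul j hj _⟩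
  obtain ⟨c, hcN, hc⟩ := hess.exists_mem_isRegular hA
  refine (h.le_of_injective (N := N)
    ((LinearMap.toSpanSingleton A A c).codRestrict N fun x => N.smul_mem x hcN) ?_).trans hN
  exact fun x y hxy => hc.right (congrArg Subtype.val hxy)

end IsExactDimension

/-- Let `A` be a prime left noetherian ring and `dim` an exact dimension
function on left `A`-modules, i.e. an isomorphism-invariant assignment of a value in the
complete linear order `{−∞} ∪ ℤ ∪ {+∞}` (here `WithBot (WithTop ℤ)`) to every left
`A`-module, such that: (i) the zero module has dimension `−∞`; (ii) for every short exact
sequence (equivalently, for every module `M` and submodule `N ⊆ M`) one has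
`dim M = max (dim N) (dim M/N)`; and (iii) the dimension of a directed union of submodules
is the supremum of their dimensions.  If `L` is a non-torsion left `A`-module, then
`dim L = dim A` (with `A` regarded as a left module over itself). -/
theorem dim_eq_dim_ring_of_nontorsion
    (A : Type v) [Ring A] [IsNoetherianRing A] (hA : IsPrimeRing' A)
    (dim : (M : Type v) → [AddCommGroup M] → [Module A M] → WithBot (WithTop ℤ))
    (hiso : ∀ (M N : Type v) [AddCommGroup M] [Module A M] [AddCommGroup N] [Module A N],
      Nonempty (M ≃ₗ[A] N) → dim M = dim N)
    (hzero : ∀ (M : Type v) [AddCommGroup M] [Module A M], Subsingleton M → dim M = ⊥)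
    (hexact : ∀ (M : Type v) [AddCommGroup M] [Module A M] (N : Submodule A M),
      dim M = max (dim N) (dim (M ⧸ N)))
    (hsup : ∀ (M : Type v) [AddCommGroup M] [Module A M] (ι : Type v)
      (N : ι → Submodule A M), Directed (· ≤ ·) N → iSup N = ⊤ →
      dim M = ⨆ i, dim (N i))
    (L : Type v) [AddCommGroup L] [Module A L] (hL : Module.IsNonTorsion A L) :
    dim L = dim A := by
  have h : IsExactDimension dim := ⟨hiso, hexact, hsup⟩
  refine le_antisymm (h.le_dim_ring L) ?_
  obtain ⟨m, hm⟩ := not_forall.mp hL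
  have hess : ¬ (Ideal.torsionOf A L m).IsEssential := fun hI => by
    obtain ⟨c, hcI, hc⟩ := hI.exists_mem_isRegular hA
    exact hm ⟨c, hc, hcI⟩
  unfold Ideal.IsEssential at hess
  push Not at hess
  obtain ⟨k, hk, hdisj⟩ := hess
  refine (h.dim_ring_le_of_ne_bot hA (J := Ideal.span {k})
    (by rwa [Ne, Ideal.span_singleton_eq_bot])).trans (h.le_of_injective
      ((LinearMap.toSpanSingleton A L m).comp (Ideal.span {k}).subtype) ?_)
  refine (injective_iff_map_eq_zero _).mpr ?_
  rintro ⟨x, hx⟩ (hxm : x • m = 0)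
  obtain ⟨w, rfl⟩ := Ideal.mem_span_singleton'.mp hx
  refine Subtype.ext ?_
  by_contra hwk
  exact hdisj w hwk hxm
end

section
/- Let A be a left noetherian ring, I a minimal injective cochain complex of left A-modules, and p a prime two-sided ideal of A. Regard Hom_A(A/p, M) as a left (A/p)-module via (b·φ)(x) := φ(x b). Then for every i, the image of the map Hom_A(A/p, I^{i−1}) → Hom_A(A/p, I^i) induced by the differential d^{i−1} is a torsion (A/p)-module; that is, for every A-linear φ : A/p → I^{i−1} there is a regular element c of A/p with c·(d^{i−1} ∘ φ) = 0. -/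
/-- A two-sided ideal `p` is *prime* if it is proper and `a b ⊆ p` implies `a ⊆ p` or
`b ⊆ p` for two-sided ideals `a`, `b`. -/
def Ideal.IsPrimeTwoSided {A : Type*} [Ring A] (p : Ideal A) : Prop :=
  p.IsTwoSidedI ∧ p ≠ ⊤ ∧
    ∀ a b : Ideal A, a.IsTwoSidedI → b.IsTwoSidedI → Ideal.prodI a b ≤ p → a ≤ p ∨ b ≤ p

section Goldie

variable {B : Type*} [Ring B]

/-- A nonempty set of elements of a left noetherian ring has an element whose left annihilator
is maximal among those of its elements. -/
theorem exists_maximal_left_annihilator_s5 [IsNoetherianRing B] {S : Set B} (hS : S.Nonempty) :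
    ∃ a ∈ S, ∀ b ∈ S, (∀ x, x * a = 0 → x * b = 0) → ∀ x, x * b = 0 → x * a = 0 := by
  obtain ⟨_, ⟨a, ha, rfl⟩, hmax⟩ := set_has_maximal_iff_noetherian.mpr
    (inferInstance : IsNoetherian B B) (Ideal.torsionOf B B '' S) (hS.image _)
  refine ⟨a, ha, fun b hb hab x hx ↦ ?_⟩
  have hle : Ideal.torsionOf B B a ≤ Ideal.torsionOf B B b := fun y hy ↦ by
    simpa using hab y (by simpa using hy)
  have heq := eq_of_le_of_not_lt hle (hmax _ ⟨b, hb, rfl⟩)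
  have hxa : x ∈ Ideal.torsionOf B B a := heq ▸ (by simpa using hx)
  simpa using hxa

/-- A nonzero left ideal of a left noetherian prime ring contains a nonzero element `e` such that
`e` and `e * e` have the same left annihilator. -/
theorem exists_ne_zero_left_annihilator_sq [IsNoetherianRing B]
    (hB : ∀ a : B, (∀ x, a * x * a = 0) → a = 0) {K : Ideal B} (hK : K ≠ ⊥) :
    ∃ e ∈ K, e ≠ 0 ∧ ∀ x, x * e * e = 0 → x * e = 0 := by
  obtain ⟨k, hk, hk0⟩ := K.ne_bot_iff.mp hK
  obtain ⟨a, ⟨haK, ha0⟩, hmax⟩ :=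
    exists_maximal_left_annihilator_s5 (S := {a : B | a ∈ K ∧ a ≠ 0}) ⟨k, hk, hk0⟩
  obtain ⟨y, hy⟩ : ∃ y, a * y * a ≠ 0 := by
    by_contra! h
    exact ha0 (hB a h)
  refine ⟨y * a, K.mul_mem_left _ haK, fun h ↦ hy (by rw [mul_assoc, h, mul_zero]),
    fun x hx ↦ ?_⟩
  rw [← mul_assoc]
  refine hmax (a * y * a) ⟨K.mul_mem_left _ haK, hy⟩ (fun z hz ↦ ?_) (x * y) ?_
  · rw [← mul_assoc, ← mul_assoc, hz, zero_mul, zero_mul]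
  · simpa only [mul_assoc] using hx

/-- A left noetherian prime ring is left nonsingular: an element with essential left annihilator
is zero. -/
theorem eq_zero_of_left_annihilator_essential [IsNoetherianRing B]
    (hB : ∀ a : B, (∀ x, a * x * a = 0) → a = 0) {z : B}
    (hz : ∀ a ≠ 0, ∃ b, b * a ≠ 0 ∧ b * a * z = 0) : z = 0 := by
  by_contra hz0
  obtain ⟨a, ⟨ha0, ha⟩, hmax⟩ := exists_maximal_left_annihilator_s5
    (S := {w : B | w ≠ 0 ∧ ∀ a ≠ 0, ∃ b, b * a ≠ 0 ∧ b * a * w = 0}) ⟨z, hz0, hz⟩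
  refine ha0 (hB a fun x ↦ ?_)
  by_contra hne
  have hess : ∀ u ≠ 0, ∃ b, b * u ≠ 0 ∧ b * u * (a * x * a) = 0 := fun u hu ↦ by
    obtain ⟨b, hb, hba⟩ := ha u hu
    exact ⟨b, hb, by rw [mul_assoc a, ← mul_assoc (b * u), hba, zero_mul]⟩
  have hmax' := hmax (a * x * a) ⟨hne, hess⟩ fun u hu ↦ by
    rw [mul_assoc a, ← mul_assoc u, hu, zero_mul]
  by_cases hax : a * x = 0
  · exact hne (by rw [hax, zero_mul])
  obtain ⟨b, hb, hba⟩ := ha (a * x) hax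
  have hb' : b * a = 0 := hmax' b (by rwa [← mul_assoc])
  exact hb (by rw [← mul_assoc, hb', zero_mul])

/-- If right multiplication by `c` is injective on a left noetherian ring, then the left ideal
generated by `c` is essential. -/
theorem exists_mul_ne_zero_eq_mul_of_left_annihilator_eq_zero [IsNoetherianRing B] {c : B}
    (hc : ∀ x, x * c = 0 → x = 0) {a : B} (ha : a ≠ 0) :
    ∃ b, b * a ≠ 0 ∧ ∃ x, b * a = x * c := by
  by_contra! h
  let f : B × Ideal.span {a} →ₗ[B] B :=
    (LinearMap.toSpanSingleton B B c).coprod (Ideal.span {a}).subtype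
  have hf : Function.Injective f := by
    rw [injective_iff_map_eq_zero]
    rintro ⟨x, k, hk⟩ hxk
    obtain ⟨b, rfl⟩ := Ideal.mem_span_singleton'.mp hk
    have hsum : x * c + b * a = 0 := by simpa [f] using hxk
    have hba : b * a = 0 := by
      by_contra hne
      exact h b hne (-x) (by rw [neg_mul]; exact eq_neg_of_add_eq_zero_right hsum)
    have hx : x = 0 := hc x (by simpa [hba] using hsum)
    simp [hx, hba]
  have := IsNoetherian.subsingleton_of_prod_injective f hf
  exact ha (congrArg Subtype.val
    (Subsingleton.elim (⟨a, Ideal.mem_span_singleton_self a⟩ : Ideal.span {a}) 0))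

/-- An essential left ideal of a left noetherian prime ring contains an element with zero left
annihilator. -/
theorem exists_mem_left_annihilator_eq_zero [IsNoetherianRing B]
    (hB : ∀ a : B, (∀ x, a * x * a = 0) → a = 0) {L : Ideal B}
    (hL : ∀ a ≠ 0, ∃ b, b * a ≠ 0 ∧ b * a ∈ L) :
    ∃ c ∈ L, ∀ x, x * c = 0 → x = 0 := by
  obtain ⟨J, ⟨c, hcL, hcc, hJc⟩, hmax⟩ := set_has_maximal_iff_noetherian.mpr
    (inferInstance : IsNoetherian B B)
    {J : Ideal B | ∃ c ∈ L, (∀ x, x * c * c = 0 → x * c = 0) ∧ ∀ j ∈ J, j * c = 0 → j = 0}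
    ⟨⊥, 0, L.zero_mem, by simp, by simp⟩
  refine ⟨c, hcL, ?_⟩
  by_contra! h
  obtain ⟨y, hyc, hy0⟩ := h
  have hK : L ⊓ Ideal.torsionOf B B c ≠ ⊥ := by
    obtain ⟨b, hb0, hbL⟩ := hL y hy0
    refine (Submodule.ne_bot_iff _).mpr ⟨b * y, ⟨hbL, ?_⟩, hb0⟩
    simp [mul_assoc, hyc]
  obtain ⟨a, ⟨haL, hac⟩, ha0, haa⟩ := exists_ne_zero_left_annihilator_sq hB hK
  replace hac : a * c = 0 := by simpa using hac
  have hsplit : ∀ x, x * (c + a) = 0 → x * c = 0 ∧ x * a = 0 := fun x hx ↦ by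
    have hxc : x * c = 0 := hcc x <| by
      simpa [mul_add, add_mul, mul_assoc, hac] using congrArg (· * c) hx
    exact ⟨hxc, by simpa [mul_add, hxc] using hx⟩
  refine hmax (J ⊔ Ideal.span {a}) ⟨c + a, L.add_mem hcL haL, fun x hx ↦ ?_, fun j hj hjc ↦ ?_⟩ ?_
  · obtain ⟨h₁, h₂⟩ := hsplit _ hx
    have hxc : x * c = 0 := hcc x (by simpa [mul_add, add_mul, mul_assoc, hac] using h₁)
    have hxa : x * a = 0 := haa x (by simpa [mul_add, hxc] using h₂)
    rw [mul_add, hxc, hxa, add_zero]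
  · obtain ⟨u, hu, v, hv, rfl⟩ := Submodule.mem_sup.mp hj
    obtain ⟨b, rfl⟩ := Ideal.mem_span_singleton'.mp hv
    obtain ⟨h₁, h₂⟩ := hsplit _ hjc
    have hu0 : u = 0 := hJc u hu (by simpa [add_mul, mul_assoc, hac] using h₁)
    rw [hu0, zero_add] at h₂ ⊢
    exact haa b h₂
  · refine left_lt_sup.mpr fun hle ↦ ha0 (hJc a (hle (Ideal.mem_span_singleton_self a)) hac)

/-- **Goldie's theorem** on regular elements: an essential left ideal of a left noetherian prime
ring contains a regular element. -/
theorem exists_mem_isRegular_of_essential [IsNoetherianRing B]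
    (hB : ∀ a : B, (∀ x, a * x * a = 0) → a = 0) {L : Ideal B}
    (hL : ∀ a ≠ 0, ∃ b, b * a ≠ 0 ∧ b * a ∈ L) :
    ∃ c ∈ L, IsRegular c := by
  obtain ⟨c, hcL, hc⟩ := exists_mem_left_annihilator_eq_zero hB hL
  refine ⟨c, hcL, fun x y hxy ↦ ?_, fun x y hxy ↦ ?_⟩
  · refine sub_eq_zero.mp (eq_zero_of_left_annihilator_essential hB fun a ha ↦ ?_)
    obtain ⟨b, hb, z, hz⟩ := exists_mul_ne_zero_eq_mul_of_left_annihilator_eq_zero hc ha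
    exact ⟨b, hb, by rw [hz, mul_assoc, mul_sub, sub_eq_zero.mpr hxy, mul_zero]⟩
  · exact sub_eq_zero.mp (hc _ (by rw [sub_mul]; exact sub_eq_zero.mpr hxy))

end Goldie

/-- An element `a` with `a A a ⊆ p` lies in the two-sided prime `p`. -/
theorem Ideal.IsPrimeTwoSided.mem_of_forall_mul_mul_mem {A : Type*} [Ring A] {p : Ideal A}
    (hp : p.IsPrimeTwoSided) {a : A} (ha : ∀ x, a * x * a ∈ p) : a ∈ p := by
  obtain ⟨htwo, -, hprime⟩ := hp
  let J : Ideal A :=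
    { carrier := {y | ∀ x, a * x * y ∈ p}
      add_mem' := fun hy hz x ↦ by rw [mul_add]; exact p.add_mem (hy x) (hz x)
      zero_mem' := fun x ↦ by simp
      smul_mem' := fun r y hy x ↦ by simpa [mul_assoc] using hy (x * r) }
  let K : Ideal A :=
    { carrier := {z | ∀ x, ∀ y ∈ J, z * x * y ∈ p}
      add_mem' := fun hz hw x y hy ↦ by
        rw [add_mul, add_mul]; exact p.add_mem (hz x y hy) (hw x y hy)
      zero_mem' := fun x y _ ↦ by simp
      smul_mem' := fun r z hz x y hy ↦ by
        simpa [mul_assoc] using p.mul_mem_left r (hz x y hy) }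
  have hJ : J.IsTwoSidedI := fun r y hy x ↦ by
    simpa [mul_assoc] using htwo r _ (hy x)
  have hK : K.IsTwoSidedI := fun r z hz x y hy ↦ by
    simpa [mul_assoc] using hz (r * x) y hy
  have hKJ : Ideal.prodI K J ≤ p := by
    refine Ideal.span_le.mpr ?_
    rintro _ ⟨z, hz, y, hy, rfl⟩
    simpa using hz 1 y hy
  rcases hprime K J hK hJ hKJ with h | h
  · exact h fun x y hy ↦ hy x
  · exact h ha

/-- Let `A` be a left noetherian ring, `I` a minimal injective cochain
complex of left `A`-modules (each `I n` injective, differentials `d n : I n → I (n+1)` with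
`d ∘ d = 0` and essential kernels), and `p` a prime two-sided ideal of `A`.  The quotient ring
`A/p` is encoded as a ring `B` together with a surjective ring homomorphism `π : A → B` with
kernel `p`; it is a left `A`-module via `a • b = π a * b`, and `Hom_A(A/p, M)` is a left
`(A/p)`-module via `(b·φ)(x) := φ(x b)`.  Then for every `i`, the image of the map
`Hom_A(A/p, I^{i−1}) → Hom_A(A/p, I^i)` induced by the differential `d^{i−1}` is a torsion
`(A/p)`-module: for every `A`-linear `φ : A/p → I^{i−1}` there is a regular element `c` of
`A/p` with `c · (d^{i−1} ∘ φ) = 0`, i.e. `d^{i−1} (φ (x * c)) = 0` for all `x : A/p`. -/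
theorem image_of_differential_is_torsion
    (A : Type*) [Ring A] [IsNoetherianRing A]
    (I : ℤ → Type*) [∀ n, AddCommGroup (I n)] [∀ n, Module A (I n)]
    (d : ∀ n : ℤ, I n →ₗ[A] I (n + 1))
    (hdd : ∀ n : ℤ, (d (n + 1)).comp (d n) = 0)
    (hinj : ∀ n, Module.Injective A (I n))
    (hess : ∀ (n : ℤ) (N : Submodule A (I n)), N ⊓ LinearMap.ker (d n) = ⊥ → N = ⊥)
    (p : Ideal A) (hp : p.IsPrimeTwoSided)
    (B : Type*) [Ring B] (π : A →+* B) (hsurj : Function.Surjective π)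
    (hker : ∀ x : A, π x = 0 ↔ x ∈ p)
    [Module A B] (hAB : ∀ (a : A) (b : B), a • b = π a * b)
    (i : ℤ) (φ : B →ₗ[A] I (i - 1)) :
    ∃ c : B, IsRegular c ∧ ∀ x : B, d (i - 1) (φ (x * c)) = 0 := by
  have : IsNoetherianRing B := isNoetherianRing_of_surjective A B π hsurj
  have hB : ∀ a : B, (∀ x, a * x * a = 0) → a = 0 := fun b hb ↦ by
    obtain ⟨a, rfl⟩ := hsurj b
    refine (hker a).mpr (hp.mem_of_forall_mul_mul_mem fun x ↦ (hker _).mp ?_)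
    simpa using hb (π x)
  let L : Ideal B :=
    { carrier := {b | d (i - 1) (φ b) = 0}
      add_mem' := fun hx hy ↦ by simp_all
      zero_mem' := by simp
      smul_mem' := fun r b hb ↦ by
        obtain ⟨a, rfl⟩ := hsurj r
        simp only [Set.mem_ofPred_eq] at hb ⊢
        rw [smul_eq_mul, ← hAB, map_smul, map_smul, hb, smul_zero] }
  have hL : ∀ a ≠ 0, ∃ b, b * a ≠ 0 ∧ b * a ∈ L := fun a ha ↦ by
    by_contra! h
    have hbot := hess (i - 1) ((Submodule.span A {a}).map φ) <| by
      rw [eq_bot_iff]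
      rintro _ ⟨⟨_, hk, rfl⟩, hker'⟩
      obtain ⟨r, rfl⟩ := Submodule.mem_span_singleton.mp hk
      have hra : r • a = 0 := by
        rw [hAB]
        by_contra hne
        exact h (π r) hne (by rw [← hAB]; exact hker')
      simp [hra]
    have hφa : φ a = 0 := by
      rw [← Submodule.mem_bot A, ← hbot]
      exact Submodule.mem_map_of_mem (Submodule.mem_span_singleton_self a)
    exact h 1 (by simpa using ha) (show d (i - 1) (φ (1 * a)) = 0 by simp [hφa])
  obtain ⟨c, hcL, hc⟩ := exists_mem_isRegular_of_essential hB hL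
  exact ⟨c, hc, fun x ↦ L.mul_mem_left x hcL⟩
end

section
/- Let A be a left noetherian ring, B a ring, L a finitely generated left A-module, M an (A, B)-bimodule (left A-module and right B-module with commuting actions), and N a flat left B-module. Then for every q ≥ 0 the canonical map Ext^q_A(L, M) ⊗_B N → Ext^q_A(L, M ⊗_B N) is an isomorphism of abelian groups. Here Ext^q_A(L, M) carries the right B-module structure obtained by functoriality of Ext^q_A(L, −) from the right B-action on M, and the canonical map sends ξ ⊗ n to the image of ξ under the map induced by the A-linear map M → M ⊗_B N, m ↦ m ⊗ n. -/
universe u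

open MulOpposite

/-- A realization of the balanced tensor product `M ⊗_B N` of a right `B`-module `M` and a
left `B`-module `N`: an abelian group `T` with a biadditive balanced map `t` that is
universal among biadditive balanced maps to abelian groups. -/
structure IsBalancedTensor (B : Type u) [Ring B]
    (M : Type u) [AddCommGroup M] [Module Bᵐᵒᵖ M]
    (N : Type u) [AddCommGroup N] [Module B N]
    (T : Type u) [AddCommGroup T] (t : M →+ N →+ T) : Prop where
  balanced : ∀ (b : B) (m : M) (n : N), t (op b • m) n = t m (b • n)
  universal : ∀ (C : Type u) [AddCommGroup C] (β : M →+ N →+ C),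
    (∀ (b : B) (m : M) (n : N), β (op b • m) n = β m (b • n)) →
    ∃! h : T →+ C, ∀ m n, h (t m n) = β m n

/-- A left `B`-module `N` is *flat* if tensoring with `N` (over `B`) preserves injectivity
of maps of right `B`-modules; tensor products are encoded by their universal property. -/
def LeftModuleFlat (B : Type u) [Ring B] (N : Type u) [AddCommGroup N] [Module B N] : Prop :=
  ∀ (K K' : Type u) [AddCommGroup K] [Module Bᵐᵒᵖ K] [AddCommGroup K'] [Module Bᵐᵒᵖ K']
    (g : K →ₗ[Bᵐᵒᵖ] K'), Function.Injective g →
    ∀ (T T' : Type u) [AddCommGroup T] [AddCommGroup T']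
      (t : K →+ N →+ T) (t' : K' →+ N →+ T'),
    IsBalancedTensor B K N T t → IsBalancedTensor B K' N T' t' →
    ∀ h : T →+ T', (∀ k n, h (t k n) = t' (g k) n) → Function.Injective h

section

variable (A : Type u) [Ring A]
variable (r : ℤ → ℕ) (d : ∀ n : ℤ, (Fin (r (n + 1)) → A) →ₗ[A] (Fin (r n) → A))

/-- Precomposition with the differential of a resolution of `L` by finite free modules,
on the Hom complex `Hom_A(A^{r •}, M')`; it is linear for any auxiliary scalar action `S`
on `M'` commuting with the `A`-action (e.g. the right `B`-action, or `ℤ`). -/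
def precompD (S : Type*) [Semiring S] (M' : Type u) [AddCommGroup M'] [Module A M']
    [Module S M'] [SMulCommClass A S M'] (q : ℤ) :
    ((Fin (r q) → A) →ₗ[A] M') →ₗ[S] ((Fin (r (q + 1)) → A) →ₗ[A] M') where
  toFun ψ := ψ.comp (d q)
  map_add' _ _ := rfl
  map_smul' _ _ := rfl

variable (M MN N : Type u)
variable [AddCommGroup M] [Module A M]
variable [AddCommGroup MN] [Module A MN]
variable [AddCommGroup N]

/-- The elementary cochain `x ↦ ψ(x) ⊗ n : A^{r q} → M ⊗_B N` associated to a cochain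
`ψ : A^{r q} → M` and `n ∈ N`, where the tensor product `M ⊗_B N` is realized by a
biadditive map `tmn` whose formation is compatible with the `A`-actions. -/
def elemCochain (tmn : M →+ N →+ MN)
    (htmnA : ∀ (a : A) (m : M) (nu : N), tmn (a • m) nu = a • tmn m nu)
    (q : ℤ) (ψ : (Fin (r q) → A) →ₗ[A] M) (nu : N) : (Fin (r q) → A) →ₗ[A] MN where
  toFun x := tmn (ψ x) nu
  map_add' x y := by simp
  map_smul' a x := by simp [htmnA]

end

section BalancedTensor

open scoped TensorProduct

variable (B : Type u) [Ring B] (N : Type u) [AddCommGroup N] [Module B N]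

/-- The subgroup of `X ⊗[ℤ] N` generated by the elements `x b ⊗ n - x ⊗ b n`. -/
def balancedRelations (X : Type u) [AddCommGroup X] [Module Bᵐᵒᵖ X] : AddSubgroup (X ⊗[ℤ] N) :=
  AddSubgroup.closure
    {z | ∃ (b : B) (x : X) (n : N), z = (op b • x) ⊗ₜ[ℤ] n - x ⊗ₜ[ℤ] (b • n)}

/-- The tensor product `X ⊗_B N` of a right and a left `B`-module. -/
abbrev BalancedTensor (X : Type u) [AddCommGroup X] [Module Bᵐᵒᵖ X] : Type u :=
  (X ⊗[ℤ] N) ⧸ balancedRelations B N X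

namespace BalancedTensor

variable {B N}
variable {X Y : Type u} [AddCommGroup X] [Module Bᵐᵒᵖ X] [AddCommGroup Y] [Module Bᵐᵒᵖ Y]

variable (B N X) in
/-- The canonical biadditive map `X × N → X ⊗_B N`. -/
def tmul : X →+ N →+ BalancedTensor B N X :=
  AddMonoidHom.mk' (fun x => (QuotientAddGroup.mk' (balancedRelations B N X)).comp
    (TensorProduct.mk ℤ X N x).toAddMonoidHom) fun x y => by
      ext n
      simp

lemma tmul_balanced (b : B) (x : X) (n : N) :
    tmul B N X (op b • x) n = tmul B N X x (b • n) :=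
  (QuotientAddGroup.eq_iff_sub_mem).2 (AddSubgroup.subset_closure ⟨b, x, n, rfl⟩)

lemma hom_ext {C : Type*} [AddCommGroup C] {f g : BalancedTensor B N X →+ C}
    (h : ∀ x n, f (tmul B N X x n) = g (tmul B N X x n)) : f = g := by
  refine QuotientAddGroup.addMonoidHom_ext _ (AddMonoidHom.ext fun z => ?_)
  induction z using TensorProduct.induction_on with
  | zero => simp
  | tmul x n => exact h x n
  | add z w hz hw => rw [map_add, map_add, hz, hw]

/-- The additive map out of `X ⊗_B N` induced by a balanced biadditive map. -/
def lift {C : Type*} [AddCommGroup C] (β : X →+ N →+ C)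
    (hβ : ∀ (b : B) (x : X) (n : N), β (op b • x) n = β x (b • n)) :
    BalancedTensor B N X →+ C :=
  QuotientAddGroup.lift _ (TensorProduct.liftAddHom β fun k x n => by simp) <| by
    rw [balancedRelations, AddSubgroup.closure_le]
    rintro _ ⟨b, x, n, rfl⟩
    simp [AddMonoidHom.mem_ker, hβ]

variable (B N X) in
lemma isBalancedTensor : IsBalancedTensor B X N (BalancedTensor B N X) (tmul B N X) where
  balanced := tmul_balanced
  universal _ _ β hβ :=
    ⟨lift β hβ, fun _ _ => rfl, fun _ hg => hom_ext fun x n => hg x n⟩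

variable (N) in
/-- Functoriality of `X ⊗_B N` in the right `B`-module `X`. -/
def map (f : X →ₗ[Bᵐᵒᵖ] Y) : BalancedTensor B N X →+ BalancedTensor B N Y :=
  lift ((tmul B N Y).comp f.toAddMonoidHom) fun b x n => by simp [tmul_balanced]

lemma map_injective (hflat : LeftModuleFlat B N) {f : X →ₗ[Bᵐᵒᵖ] Y}
    (hf : Function.Injective f) : Function.Injective (map N f) :=
  hflat X Y f hf _ _ _ _ (isBalancedTensor B N X) (isBalancedTensor B N Y) _ fun _ _ => rfl

/-- Right exactness: the kernel of `X ⊗_B N → (X / p) ⊗_B N` comes from `p ⊗_B N`. -/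
lemma mem_range_map_subtype_of_map_mkQ_eq_zero (p : Submodule Bᵐᵒᵖ X)
    {w : BalancedTensor B N X} (hw : map N p.mkQ w = 0) :
    w ∈ (map N p.subtype).range := by
  let Q := BalancedTensor B N X ⧸ (map N p.subtype).range
  let π : BalancedTensor B N X →+ Q := QuotientAddGroup.mk' _
  let β : X →+ N →+ Q := AddMonoidHom.mk' (fun x => π.comp (tmul B N X x)) fun x y => by
    ext n
    simp
  let γ : (X ⧸ p) →+ N →+ Q := QuotientAddGroup.lift p.toAddSubgroup β fun x hx => by
    ext n
    exact (QuotientAddGroup.eq_zero_iff _).2 ⟨tmul B N p ⟨x, hx⟩ n, rfl⟩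
  have hγ (b : B) (x : X ⧸ p) (n : N) : γ (op b • x) n = γ x (b • n) := by
    obtain ⟨x, rfl⟩ := p.mkQ_surjective x
    exact congrArg π (tmul_balanced b x n)
  have h : (lift γ hγ).comp (map N p.mkQ) = π := hom_ext fun _ _ => rfl
  refine (QuotientAddGroup.eq_zero_iff _).1 (?_ : π w = 0)
  rw [← h, AddMonoidHom.comp_apply, hw, map_zero]

lemma mem_range_map_ker_subtype (hflat : LeftModuleFlat B N) (f : X →ₗ[Bᵐᵒᵖ] Y)
    {w : BalancedTensor B N X} (hw : map N f w = 0) :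
    w ∈ (map N (LinearMap.ker f).subtype).range := by
  let g : (X ⧸ LinearMap.ker f) →ₗ[Bᵐᵒᵖ] Y := (LinearMap.ker f).liftQ f le_rfl
  have hg : Function.Injective g :=
    LinearMap.ker_eq_bot.1 (Submodule.ker_liftQ_eq_bot _ _ le_rfl le_rfl)
  have h : (map N g).comp (map N (LinearMap.ker f).mkQ) = map N f := hom_ext fun _ _ => rfl
  refine mem_range_map_subtype_of_map_mkQ_eq_zero _ (map_injective hflat hg ?_)
  rw [map_zero, ← hw, ← h, AddMonoidHom.comp_apply]

end BalancedTensor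

lemma IsBalancedTensor.hom_ext {B : Type u} [Ring B] {M : Type u} [AddCommGroup M]
    [Module Bᵐᵒᵖ M] {N : Type u} [AddCommGroup N] [Module B N] {T : Type u} [AddCommGroup T]
    {t : M →+ N →+ T} (ht : IsBalancedTensor B M N T t) {C : Type u} [AddCommGroup C]
    {f g : T →+ C} (h : ∀ m n, f (t m n) = g (t m n)) : f = g := by
  let β : M →+ N →+ C := AddMonoidHom.mk' (fun m => g.comp (t m)) fun x y => by
    ext n
    simp
  exact (ht.universal C β fun b m n => congrArg g (ht.balanced b m n)).unique h fun _ _ => rfl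

end BalancedTensor

section Cochains

open BalancedTensor

variable {A B : Type u} [Ring A] [Ring B]
variable {M : Type u} [AddCommGroup M] [Module A M] [Module Bᵐᵒᵖ M] [SMulCommClass A Bᵐᵒᵖ M]
variable {N : Type u} [AddCommGroup N] [Module B N]
variable {MN : Type u} [AddCommGroup MN] [Module A MN] {tmn : M →+ N →+ MN}
variable (r : ℤ → ℕ)

/-- The map `Hom_A(A^{r q}, M) ⊗_B N → Hom_A(A^{r q}, M ⊗_B N)`. -/
def cochainMap (htmn : IsBalancedTensor B M N MN tmn)
    (htmnA : ∀ (a : A) (m : M) (nu : N), tmn (a • m) nu = a • tmn m nu) (q : ℤ) :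
    BalancedTensor B N ((Fin (r q) → A) →ₗ[A] M) →+ ((Fin (r q) → A) →ₗ[A] MN) :=
  lift
    (AddMonoidHom.mk' (fun ψ => AddMonoidHom.mk' (elemCochain A r M MN N tmn htmnA q ψ)
      fun n n' => LinearMap.ext fun x => map_add (tmn (ψ x)) n n')
      fun ψ ψ' => by
        ext n : 1
        refine LinearMap.ext fun x => ?_
        exact DFunLike.congr_fun (map_add tmn (ψ x) (ψ' x)) n)
    fun b ψ n => LinearMap.ext fun x => htmn.balanced b (ψ x) n

variable (htmn : IsBalancedTensor B M N MN tmn)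
    (htmnA : ∀ (a : A) (m : M) (nu : N), tmn (a • m) nu = a • tmn m nu) (q : ℤ)

lemma precompD_cochainMap (d : ∀ n : ℤ, (Fin (r (n + 1)) → A) →ₗ[A] (Fin (r n) → A))
    (w : BalancedTensor B N ((Fin (r q) → A) →ₗ[A] M)) :
    precompD A r d ℤ MN q (cochainMap r htmn htmnA q w) =
      cochainMap r htmn htmnA (q + 1) (map N (precompD A r d Bᵐᵒᵖ M q) w) :=
  DFunLike.congr_fun (hom_ext (f := (precompD A r d ℤ MN q).toAddMonoidHom.comp
    (cochainMap r htmn htmnA q)) (g := (cochainMap r htmn htmnA (q + 1)).comp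
      (map N (precompD A r d Bᵐᵒᵖ M q))) fun _ _ => rfl) w

variable (A B M) in
/-- The `B`-linear map sending `m` to the cochain `x ↦ x i • m`. -/
def coordCochain (k : ℕ) (i : Fin k) : M →ₗ[Bᵐᵒᵖ] ((Fin k → A) →ₗ[A] M) where
  toFun m := (LinearMap.toSpanSingleton A M m).comp (LinearMap.proj i)
  map_add' m m' := by
    refine LinearMap.ext fun x => ?_
    simp
  map_smul' b m := by
    refine LinearMap.ext fun x => ?_
    simp [smul_comm]

lemma sum_smul_apply_single {k : ℕ} {P : Type*} [AddCommGroup P] [Module A P]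
    (f : (Fin k → A) →ₗ[A] P) (x : Fin k → A) :
    ∑ i, x i • f (Pi.single i 1) = f x := by
  conv_rhs => rw [pi_eq_sum_univ' x]
  simp [map_sum]

theorem cochainMap_bijective : Function.Bijective (cochainMap r htmn htmnA q) := by
  let C := (Fin (r q) → A) →ₗ[A] M
  have key (i : Fin (r q)) : ∃ θ : MN →+ BalancedTensor B N C,
      ∀ m n, θ (tmn m n) = tmul B N C (coordCochain A B M (r q) i m) n := by
    obtain ⟨θ, hθ, -⟩ := htmn.universal (BalancedTensor B N C)
      ((tmul B N C).comp (coordCochain A B M (r q) i).toAddMonoidHom)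
      fun b m n => by simp [tmul_balanced]
    exact ⟨θ, hθ⟩
  choose θ hθ using key
  let inv : ((Fin (r q) → A) →ₗ[A] MN) →+ BalancedTensor B N C :=
    ∑ i, (θ i).comp (LinearMap.applyₗ' ℤ (Pi.single i 1)).toAddMonoidHom
  have hinv (f) : inv f = ∑ i, θ i (f (Pi.single i 1)) := by
    simp [inv, AddMonoidHom.finsetSum_apply]
  have left : inv.comp (cochainMap r htmn htmnA q) = AddMonoidHom.id _ := by
    refine hom_ext fun ψ n => ?_
    have hψ : ∑ i, coordCochain A B M (r q) i (ψ (Pi.single i 1)) = ψ := by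
      refine LinearMap.ext fun x => ?_
      rw [← sum_smul_apply_single ψ x, LinearMap.sum_apply]
      rfl
    calc inv (cochainMap r htmn htmnA q (tmul B N C ψ n))
        = ∑ i, θ i (tmn (ψ (Pi.single i 1)) n) := hinv _
      _ = tmul B N C (∑ i, coordCochain A B M (r q) i (ψ (Pi.single i 1))) n := by
        simp only [hθ, map_sum, AddMonoidHom.finsetSum_apply]
      _ = tmul B N C ψ n := by rw [hψ]
  have right (f) : cochainMap r htmn htmnA q (inv f) = f := by
    refine LinearMap.ext fun x => ?_
    have hx (i) (μ : MN) : cochainMap r htmn htmnA q (θ i μ) x = x i • μ := by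
      let ev : ((Fin (r q) → A) →ₗ[A] MN) →+ MN := (LinearMap.applyₗ' ℤ x).toAddMonoidHom
      refine DFunLike.congr_fun (htmn.hom_ext
        (f := ev.comp ((cochainMap r htmn htmnA q).comp (θ i)))
        (g := DistribSMul.toAddMonoidHom MN (x i)) fun m n => ?_) μ
      change cochainMap r htmn htmnA q (θ i (tmn m n)) x = x i • tmn m n
      rw [hθ, ← htmnA]
      rfl
    rw [hinv, map_sum, LinearMap.sum_apply, ← sum_smul_apply_single f x]
    exact Finset.sum_congr rfl fun i _ => hx i _
  exact ⟨Function.LeftInverse.injective (g := inv) (DFunLike.congr_fun left),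
    Function.RightInverse.surjective right⟩

end Cochains

set_option maxHeartbeats 1000000 in
/-- Let `A` be a left noetherian ring, `B` a ring, `L` a finitely
generated left `A`-module (with a chosen resolution by finitely generated free modules
`A^{r n}`, which exists by hypothesis), `M` an `(A,B)`-bimodule, and `N` a flat left
`B`-module.  Then for every `q ≥ 0` (written `q = n + 1` with the complex vanishing in
negative degrees) the canonical map `Ext^q_A(L, M) ⊗_B N → Ext^q_A(L, M ⊗_B N)`, sending
`ξ ⊗ n` to the image of `ξ` under the map induced by `m ↦ m ⊗ n`, is an isomorphism of
abelian groups.  Here `Ext^q_A(L, M)` is computed as the cohomology of `Hom_A(A^{r •}, M)`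
(with its right `B`-module structure obtained from the right `B`-action on `M`), the
tensor products `M ⊗_B N` and `Ext^q_A(L, M) ⊗_B N` are encoded by their universal
properties, and the canonical map is any additive map `Θ` sending the class of `ψ ⊗ n` to
the class of the cocycle `x ↦ ψ(x) ⊗ n`. -/
theorem ext_tensor_flat_iso
    (A B : Type u) [Ring A] [Ring B] [IsNoetherianRing A]
    (L : Type u) [AddCommGroup L] [Module A L] [Module.Finite A L]
    (M : Type u) [AddCommGroup M] [Module A M] [Module Bᵐᵒᵖ M] [SMulCommClass A Bᵐᵒᵖ M]
    (N : Type u) [AddCommGroup N] [Module B N]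
    (hflat : LeftModuleFlat B N)
    -- a resolution of `L` by finitely generated free `A`-modules
    (r : ℤ → ℕ) (hrneg : ∀ n : ℤ, n < 0 → r n = 0)
    (d : ∀ n : ℤ, (Fin (r (n + 1)) → A) →ₗ[A] (Fin (r n) → A))
    (ε : (Fin (r 0) → A) →ₗ[A] L)
    (hsurj : Function.Surjective ε)
    (hex0 : LinearMap.ker ε = LinearMap.range (d 0))
    (hexact : ∀ n : ℤ, 0 ≤ n → LinearMap.ker (d n) = LinearMap.range (d (n + 1)))
    -- the tensor product `MN = M ⊗_B N`, with its left `A`-module structure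
    (MN : Type u) [AddCommGroup MN] [Module A MN] (tmn : M →+ N →+ MN)
    (htmn : IsBalancedTensor B M N MN tmn)
    (htmnA : ∀ (a : A) (m : M) (nu : N), tmn (a • m) nu = a • tmn m nu)
    (n : ℤ)
    -- the tensor product `T = Ext^{n+1}_A(L, M) ⊗_B N`
    (T : Type u) [AddCommGroup T]
    (t : ((LinearMap.ker (precompD A r d Bᵐᵒᵖ M (n + 1))) ⧸
        (Submodule.comap (LinearMap.ker (precompD A r d Bᵐᵒᵖ M (n + 1))).subtype
          (LinearMap.range (precompD A r d Bᵐᵒᵖ M n)))) →+ N →+ T)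
    (ht : IsBalancedTensor B
      ((LinearMap.ker (precompD A r d Bᵐᵒᵖ M (n + 1))) ⧸
        (Submodule.comap (LinearMap.ker (precompD A r d Bᵐᵒᵖ M (n + 1))).subtype
          (LinearMap.range (precompD A r d Bᵐᵒᵖ M n)))) N T t)
    -- the canonical map `Θ : Ext^{n+1}(L,M) ⊗_B N → Ext^{n+1}(L, M ⊗_B N)`
    (Θ : T →+ ((LinearMap.ker (precompD A r d ℤ MN (n + 1))) ⧸
        (Submodule.comap (LinearMap.ker (precompD A r d ℤ MN (n + 1))).subtype
          (LinearMap.range (precompD A r d ℤ MN n)))))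
    (hΘ : ∀ (ψ : LinearMap.ker (precompD A r d Bᵐᵒᵖ M (n + 1))) (nu : N),
      Θ (t (Submodule.Quotient.mk ψ) nu) =
        Submodule.Quotient.mk
          ⟨elemCochain A r M MN N tmn htmnA (n + 1) ψ.1 nu, by
            rw [LinearMap.mem_ker]
            refine LinearMap.ext fun x => ?_
            have hx : ψ.1 (d (n + 1) x) = 0 := DFunLike.congr_fun ψ.2 x
            show tmn (ψ.1 (d (n + 1) x)) nu = 0
            rw [hx]
            simp⟩) :
    Function.Bijective Θ := by
  have hdd (k : ℤ) (x) : d k (d (k + 1) x) = 0 := by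
    rcases lt_or_ge k 0 with hk | hk
    · have : IsEmpty (Fin (r k)) := by
        rw [hrneg k hk]
        infer_instance
      exact Subsingleton.elim _ _
    · exact LinearMap.mem_ker.1 (hexact k hk ▸ LinearMap.mem_range_self _ x)
  let Z := LinearMap.ker (precompD A r d Bᵐᵒᵖ M (n + 1))
  let φ := cochainMap r htmn htmnA
  let ι := BalancedTensor.map N Z.subtype
  -- the map `Z ⊗_B N → T` induced by the projection from cocycles to cohomology
  let π : BalancedTensor B N Z →+ T :=
    BalancedTensor.lift (t.comp (Submodule.mkQ _).toAddMonoidHom) fun b ψ nu =>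
      ht.balanced b (Submodule.Quotient.mk ψ) nu
  have hcocycle (w) : φ (n + 1) (ι w) ∈ LinearMap.ker (precompD A r d ℤ MN (n + 1)) := by
    have h0 : (BalancedTensor.map N (precompD A r d Bᵐᵒᵖ M (n + 1))).comp ι = 0 :=
      BalancedTensor.hom_ext fun ψ nu => by
        change BalancedTensor.tmul B N _ (precompD A r d Bᵐᵒᵖ M (n + 1) ψ.1) nu = 0
        rw [LinearMap.mem_ker.1 ψ.2]
        simp
    rw [LinearMap.mem_ker, precompD_cochainMap]
    exact (congrArg _ (DFunLike.congr_fun h0 w)).trans (map_zero _)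
  have hΘπ (w) : Θ (π w) = Submodule.Quotient.mk ⟨φ (n + 1) (ι w), hcocycle w⟩ := by
    let κ : BalancedTensor B N Z →+ LinearMap.ker (precompD A r d ℤ MN (n + 1)) :=
      ((φ (n + 1)).comp ι).codRestrict _ hcocycle
    exact DFunLike.congr_fun (BalancedTensor.hom_ext (f := Θ.comp π)
      (g := (Submodule.mkQ _).toAddMonoidHom.comp κ) fun ψ nu => hΘ ψ nu) w
  have hπ : Function.Surjective π := by
    rw [← AddMonoidHom.range_eq_top, ← QuotientAddGroup.ker_mk' π.range,
      AddMonoidHom.ker_eq_top_iff]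
    refine ht.hom_ext fun ξ nu => ?_
    obtain ⟨ψ, rfl⟩ := Submodule.Quotient.mk_surjective _ ξ
    exact (QuotientAddGroup.eq_zero_iff _).2 ⟨BalancedTensor.tmul B N Z ψ nu, rfl⟩
  constructor
  · refine (injective_iff_map_eq_zero Θ).2 fun τ hτ => ?_
    obtain ⟨w, rfl⟩ := hπ τ
    rw [hΘπ, Submodule.Quotient.mk_eq_zero] at hτ
    obtain ⟨f, hf⟩ := hτ
    obtain ⟨y, rfl⟩ := (cochainMap_bijective r htmn htmnA n).2 f
    let α : ((Fin (r n) → A) →ₗ[A] M) →ₗ[Bᵐᵒᵖ] Z :=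
      (precompD A r d Bᵐᵒᵖ M n).codRestrict _ fun ψ => LinearMap.ext fun x =>
        (congrArg ψ (hdd n x)).trans (map_zero ψ)
    have hια : ι.comp (BalancedTensor.map N α) =
        BalancedTensor.map N (precompD A r d Bᵐᵒᵖ M n) :=
      BalancedTensor.hom_ext fun _ _ => rfl
    have hπα : π.comp (BalancedTensor.map N α) = 0 := BalancedTensor.hom_ext fun ψ nu => by
      have h : Submodule.Quotient.mk (α ψ) = (0 : Z ⧸ Submodule.comap Z.subtype
          (LinearMap.range (precompD A r d Bᵐᵒᵖ M n))) :=
        (Submodule.Quotient.mk_eq_zero _).2 ⟨ψ, rfl⟩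
      change t (Submodule.Quotient.mk (α ψ)) nu = 0
      rw [h]
      simp
    have hw : BalancedTensor.map N α y = w := by
      refine BalancedTensor.map_injective hflat Z.injective_subtype
        ((cochainMap_bijective r htmn htmnA (n + 1)).1 ?_)
      refine Eq.trans ?_ hf
      rw [precompD_cochainMap, ← hια]
      rfl
    rw [← hw]
    exact DFunLike.congr_fun hπα y
  · intro ξ
    obtain ⟨⟨f, hf⟩, rfl⟩ := Submodule.Quotient.mk_surjective _ ξ
    obtain ⟨v, rfl⟩ := (cochainMap_bijective r htmn htmnA (n + 1)).2 f
    rw [LinearMap.mem_ker, precompD_cochainMap] at hf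
    obtain ⟨w, rfl⟩ := BalancedTensor.mem_range_map_ker_subtype hflat _
      ((cochainMap_bijective r htmn htmnA (n + 1 + 1)).1 (hf.trans (map_zero _).symm))
    exact ⟨π w, hΘπ w⟩
end

section
/- Let A be a left noetherian ring, L a finitely generated left A-module, A → A′ a ring homomorphism such that A′ is flat as a right A-module, and M a left A′-module. Then for every q ≥ 0 the canonical map Ext^q_A(L, M) → Ext^q_{A′}(A′ ⊗_A L, M) is an isomorphism, where on the left-hand side M is regarded as a left A-module by restriction of scalars, and the map is induced by the adjunction between extension of scalars A′ ⊗_A − and restriction of scalars. -/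
universe u

open MulOpposite

/-- A right `B`-module `M` is *flat* if tensoring with `M` (over `B`) preserves injectivity
of maps of left `B`-modules; tensor products are encoded by their universal property. -/
def RightModuleFlat (B : Type u) [Ring B] (M : Type u) [AddCommGroup M] [Module Bᵐᵒᵖ M] :
    Prop :=
  ∀ (N N' : Type u) [AddCommGroup N] [Module B N] [AddCommGroup N'] [Module B N']
    (g : N →ₗ[B] N'), Function.Injective g →
    ∀ (T T' : Type u) [AddCommGroup T] [AddCommGroup T']
      (t : M →+ N →+ T) (t' : M →+ N' →+ T'),
    IsBalancedTensor B M N T t → IsBalancedTensor B M N' T' t' →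
    ∀ h : T →+ T', (∀ m n, h (t m n) = t' m (g n)) → Function.Injective h

variable {A A' : Type u} [Ring A] [Ring A']

/-- The homomorphism `Hom_A(A^s, M) → Hom_{A'}(A'^s, M)` of the adjunction
`Hom_A(P, M) ≅ Hom_{A'}(A' ⊗_A P, M)` for a finite free module `P = A^s`,
where `M` is a left `A'`-module (hence an `A`-module via `ρ : A → A'`). -/
def extendHom {M : Type u} [AddCommGroup M] [Module A M] [Module A' M]
    (s : ℕ) (ψ : (Fin s → A) →ₗ[A] M) : (Fin s → A') →ₗ[A'] M where
  toFun v := ∑ j, v j • ψ (Pi.single j 1)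
  map_add' v w := by
    simp [add_smul, Finset.sum_add_distrib]
  map_smul' c v := by
    simp [mul_smul, Finset.smul_sum]

/-- The biadditive map `A' × A^s → A'^s`, `(x, v) ↦ (x * ρ (v j))_j`. -/
def scalarExtension (ρ : A →+* A') (s : ℕ) : A' →+ (Fin s → A) →+ (Fin s → A') :=
  AddMonoidHom.mk'
    (fun x => AddMonoidHom.mk' (fun v j => x * ρ (v j))
      (fun v w => by ext j; simp [mul_add]))
    (fun x y => by ext v j; simp [add_mul])

@[simp]
theorem scalarExtension_apply (ρ : A →+* A') (s : ℕ) (x : A') (v : Fin s → A) (j : Fin s) :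
    scalarExtension ρ s x v j = x * ρ (v j) := rfl

theorem sum_smul_map_single {N : Type u} [AddCommGroup N] [Module A N] {s : ℕ}
    (f : (Fin s → A) →ₗ[A] N) (v : Fin s → A) : ∑ j, v j • f (Pi.single j 1) = f v := by
  conv_rhs => rw [pi_eq_sum_univ' v, map_sum]
  simp

/-- `f'` is the matrix of `f` with entries mapped along `ρ`. -/
def IsScalarExtension (ρ : A →+* A') {a b : ℕ} (f : (Fin a → A) →ₗ[A] (Fin b → A))
    (f' : (Fin a → A') →ₗ[A'] (Fin b → A')) : Prop :=
  ∀ (v : Fin a → A') (i : Fin b), f' v i = ∑ j, v j * ρ (f (Pi.single j 1) i)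

theorem IsScalarExtension.map_scalarExtension {ρ : A →+* A'} {a b : ℕ}
    {f : (Fin a → A) →ₗ[A] (Fin b → A)} {f' : (Fin a → A') →ₗ[A'] (Fin b → A')}
    (h : IsScalarExtension ρ f f') (x : A') (v : Fin a → A) :
    f' (scalarExtension ρ a x v) = scalarExtension ρ b x (f v) := by
  ext i
  rw [h, scalarExtension_apply, ← sum_smul_map_single f v]
  simp [Finset.mul_sum, mul_assoc]

theorem sum_scalarExtension_single (ρ : A →+* A') (s : ℕ) (v : Fin s → A') :
    ∑ j, scalarExtension ρ s (v j) (Pi.single j 1) = v := by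
  ext i
  simp [Finset.sum_apply, Pi.single_apply, apply_ite ρ]

section Balanced

variable {ρ : A →+* A'} {N : Type u} [AddCommGroup N] [Module A N] {C : Type u} [AddCommGroup C]
  {β : A' →+ N →+ C}

/-- The map `A'^s → C`, `v ↦ ∑ j, β (v j) (π e_j)`. -/
def sumSingle (β : A' →+ N →+ C) {s : ℕ} (π : (Fin s → A) →ₗ[A] N) : (Fin s → A') →+ C :=
  AddMonoidHom.mk' (fun v => ∑ j, β (v j) (π (Pi.single j 1)))
    (fun v w => by simp [Finset.sum_add_distrib])

theorem sumSingle_apply (β : A' →+ N →+ C) {s : ℕ} (π : (Fin s → A) →ₗ[A] N)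
    (v : Fin s → A') : sumSingle β π v = ∑ j, β (v j) (π (Pi.single j 1)) := rfl

theorem sumSingle_scalarExtension
    [Module Aᵐᵒᵖ A'] (hop : ∀ (a : A) (x : A'), op a • x = x * ρ a)
    (hβ : ∀ (b : A) (m : A') (n : N), β (op b • m) n = β m (b • n))
    {s : ℕ} (π : (Fin s → A) →ₗ[A] N) (x : A') (v : Fin s → A) :
    sumSingle β π (scalarExtension ρ s x v) = β x (π v) := by
  rw [sumSingle_apply, ← sum_smul_map_single π v, map_sum]
  exact Finset.sum_congr rfl fun j _ => by rw [scalarExtension_apply, ← hop, hβ]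

theorem sumSingle_comp_eq_zero
    [Module Aᵐᵒᵖ A'] (hop : ∀ (a : A) (x : A'), op a • x = x * ρ a)
    (hβ : ∀ (b : A) (m : A') (n : N), β (op b • m) n = β m (b • n))
    {a s : ℕ} {f : (Fin a → A) →ₗ[A] (Fin s → A)} {f' : (Fin a → A') →ₗ[A'] (Fin s → A')}
    (hf : IsScalarExtension ρ f f') (π : (Fin s → A) →ₗ[A] N) (hπ : ∀ v, π (f v) = 0)
    (w : Fin a → A') : sumSingle β π (f' w) = 0 := by
  rw [← sum_scalarExtension_single ρ a w, map_sum, map_sum]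
  exact Finset.sum_eq_zero fun j _ => by
    rw [hf.map_scalarExtension, sumSingle_scalarExtension hop hβ, hπ, map_zero]

/-- A cokernel presentation of `N` by finite free modules gives, after extension of scalars,
a cokernel presentation of `A' ⊗_A N`. -/
theorem isBalancedTensor_of_presentation
    [Module Aᵐᵒᵖ A'] (hop : ∀ (a : A) (x : A'), op a • x = x * ρ a) {a s : ℕ}
    {f : (Fin a → A) →ₗ[A] (Fin s → A)} {f' : (Fin a → A') →ₗ[A'] (Fin s → A')}
    (hf : IsScalarExtension ρ f f') (π : (Fin s → A) →ₗ[A] N)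
    (hπ : Function.Surjective π) (hπf : ∀ v, π (f v) = 0)
    {T : Type u} [AddCommGroup T] (p : (Fin s → A') →+ T) (hp : Function.Surjective p)
    (hker : ∀ v, p v = 0 → v ∈ LinearMap.range f')
    (t : A' →+ N →+ T) (ht : ∀ x v, t x (π v) = p (scalarExtension ρ s x v)) :
    IsBalancedTensor A A' N T t where
  balanced b x n := by
    obtain ⟨v, rfl⟩ := hπ n
    rw [← map_smul, ht, ht, hop]
    congr 1
    ext j
    simp [mul_assoc]
  universal C _ β hβ := by
    have hle : p.ker ≤ (sumSingle β π).ker := fun v hv => by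
      obtain ⟨w, rfl⟩ := hker v hv
      exact sumSingle_comp_eq_zero hop hβ hf π hπf w
    refine ⟨p.liftOfSurjective hp ⟨sumSingle β π, hle⟩, fun x n => ?_, fun h hh => ?_⟩
    · obtain ⟨v, rfl⟩ := hπ n
      rw [ht]
      refine (p.liftOfRightInverse_comp_apply _ _ _ _).trans ?_
      exact sumSingle_scalarExtension hop hβ π x v
    · refine p.eq_liftOfRightInverse _ _ _ hle h ?_
      refine AddMonoidHom.ext fun v => ?_
      rw [AddMonoidHom.comp_apply, sumSingle_apply]
      conv_lhs => rw [← sum_scalarExtension_single ρ s v]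
      rw [map_sum, map_sum]
      exact Finset.sum_congr rfl fun j _ => by rw [← ht, hh]

theorem exists_tensorMap_of_presentation {a s : ℕ}
    {f : (Fin a → A) →ₗ[A] (Fin s → A)} {f' : (Fin a → A') →ₗ[A'] (Fin s → A')}
    (hf : IsScalarExtension ρ f f') (π : (Fin s → A) →ₗ[A] N)
    (hπ : Function.Surjective π) (hπf : LinearMap.ker π = LinearMap.range f) :
    ∃ t : A' →+ N →+ ((Fin s → A') ⧸ LinearMap.range f'),
      ∀ x v, t x (π v) = (LinearMap.range f').mkQ (scalarExtension ρ s x v) := by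
  let p : A' → (Fin s → A) →+ ((Fin s → A') ⧸ LinearMap.range f') := fun x =>
    (LinearMap.range f').mkQ.toAddMonoidHom.comp (scalarExtension ρ s x)
  have hle : ∀ x, π.toAddMonoidHom.ker ≤ (p x).ker := fun x v hv => by
    have hv' : v ∈ LinearMap.ker π := hv
    rw [hπf] at hv'
    obtain ⟨w, rfl⟩ := hv'
    refine (Submodule.Quotient.mk_eq_zero _).2 ⟨scalarExtension ρ a x w, ?_⟩
    exact hf.map_scalarExtension x w
  let l : A' → N →+ ((Fin s → A') ⧸ LinearMap.range f') := fun x =>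
    π.toAddMonoidHom.liftOfSurjective hπ ⟨p x, hle x⟩
  have hl : ∀ x v, l x (π v) = p x v := fun x v =>
    π.toAddMonoidHom.liftOfRightInverse_comp_apply _ _ _ _
  refine ⟨AddMonoidHom.mk' l fun x y => ?_, hl⟩
  ext n
  obtain ⟨v, rfl⟩ := hπ n
  rw [AddMonoidHom.add_apply, hl, hl, hl]
  simp [p]

theorem RightModuleFlat.ker_eq_range
    [Module Aᵐᵒᵖ A'] (hop : ∀ (a : A) (x : A'), op a • x = x * ρ a) (hflat : RightModuleFlat A A') {a b c : ℕ}
    {f : (Fin a → A) →ₗ[A] (Fin b → A)} {f' : (Fin a → A') →ₗ[A'] (Fin b → A')}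
    (hf : IsScalarExtension ρ f f')
    {g : (Fin b → A) →ₗ[A] (Fin c → A)} {g' : (Fin b → A') →ₗ[A'] (Fin c → A')}
    (hg : IsScalarExtension ρ g g') (h : LinearMap.ker g = LinearMap.range f) :
    LinearMap.ker g' = LinearMap.range f' := by
  have hgf : ∀ v, g (f v) = 0 := fun v => by
    have : f v ∈ LinearMap.ker g := h ▸ LinearMap.mem_range_self f v
    exact this
  have hgf' : LinearMap.range f' ≤ LinearMap.ker g' := by
    rintro _ ⟨w, rfl⟩
    rw [LinearMap.mem_ker, ← sum_scalarExtension_single ρ a w, map_sum, map_sum]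
    exact Finset.sum_eq_zero fun j _ => by
      rw [hf.map_scalarExtension, hg.map_scalarExtension, hgf, map_zero]
  refine le_antisymm (fun v hv => ?_) hgf'
  obtain ⟨t, ht⟩ := exists_tensorMap_of_presentation hf (LinearMap.range f).mkQ
    (Submodule.mkQ_surjective _) (Submodule.ker_mkQ _)
  have hT := isBalancedTensor_of_presentation hop hf (LinearMap.range f).mkQ
    (Submodule.mkQ_surjective _)
    (fun v => (Submodule.Quotient.mk_eq_zero _).2 (LinearMap.mem_range_self f v))
    (LinearMap.range f').mkQ.toAddMonoidHom (Submodule.mkQ_surjective _)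
    (fun v hv => (Submodule.Quotient.mk_eq_zero _).1 hv) t ht
  have hT' := isBalancedTensor_of_presentation (ρ := ρ) (a := 0) (s := c) (f := 0) (f' := 0)
    hop (fun _ _ => by simp) LinearMap.id Function.surjective_id (fun _ => rfl)
    (AddMonoidHom.id _) Function.surjective_id (fun v hv => ⟨0, by simpa using Eq.symm hv⟩)
    (scalarExtension ρ c) (fun _ _ => rfl)
  have hinj := hflat _ _ ((LinearMap.range f).liftQ g h.ge)
    (LinearMap.ker_eq_bot.1 (Submodule.ker_liftQ_eq_bot _ _ _ h.le)) _ _ _ _ hT hT'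
    ((LinearMap.range f').liftQ g' hgf').toAddMonoidHom (fun x n => by
      obtain ⟨v, rfl⟩ := Submodule.mkQ_surjective _ n
      rw [ht]
      exact hg.map_scalarExtension x v)
  refine (Submodule.Quotient.mk_eq_zero _).1 (hinj ?_)
  rw [map_zero]
  exact hv

theorem IsBalancedTensor.ker_eq_range
    [Module Aᵐᵒᵖ A'] (hop : ∀ (a : A) (x : A'), op a • x = x * ρ a) {a s : ℕ}
    {f : (Fin a → A) →ₗ[A] (Fin s → A)} {f' : (Fin a → A') →ₗ[A'] (Fin s → A')}
    (hf : IsScalarExtension ρ f f') (π : (Fin s → A) →ₗ[A] N)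
    (hπ : Function.Surjective π) (hπf : LinearMap.ker π = LinearMap.range f)
    {T : Type u} [AddCommGroup T] [Module A' T] {t : A' →+ N →+ T}
    (ht : IsBalancedTensor A A' N T t)
    (π' : (Fin s → A') →ₗ[A'] T) (hπ' : ∀ v, π' v = sumSingle t π v) :
    LinearMap.ker π' = LinearMap.range f' := by
  have hπf₀ : ∀ v, π (f v) = 0 := fun v => by
    have : f v ∈ LinearMap.ker π := hπf ▸ LinearMap.mem_range_self f v
    exact this
  refine le_antisymm (fun v hv => ?_) ?_
  · obtain ⟨t₀, ht₀⟩ := exists_tensorMap_of_presentation hf π hπ hπf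
    have hT₀ := isBalancedTensor_of_presentation hop hf π hπ hπf₀
      (LinearMap.range f').mkQ.toAddMonoidHom (Submodule.mkQ_surjective _)
      (fun v hv => (Submodule.Quotient.mk_eq_zero _).1 hv) t₀ ht₀
    obtain ⟨h, hh, -⟩ := ht.universal _ t₀ hT₀.balanced
    refine (Submodule.Quotient.mk_eq_zero _).1 (?_ : (LinearMap.range f').mkQ v = 0)
    have : h (π' v) = (LinearMap.range f').mkQ v := by
      conv_rhs => rw [← sum_scalarExtension_single ρ s v]
      rw [hπ', sumSingle_apply, map_sum, map_sum]
      exact Finset.sum_congr rfl fun j _ => by rw [hh, ht₀]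
    rw [← this, LinearMap.mem_ker.1 hv, map_zero]
  · rintro _ ⟨w, rfl⟩
    rw [LinearMap.mem_ker, hπ']
    exact sumSingle_comp_eq_zero hop ht.balanced hf π hπf₀ w

end Balanced

section Acyclic

theorem exists_section_rangeRestrict {X Y : Type u} [AddCommGroup X] [Module A X]
    [AddCommGroup Y] [Module A Y] (f : X →ₗ[A] Y) [Module.Projective A (LinearMap.range f)] :
    ∃ s : LinearMap.range f →ₗ[A] X, ∀ y, f (s y) = y := by
  obtain ⟨s, hs⟩ := f.rangeRestrict.exists_rightInverse_of_surjective f.range_rangeRestrict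
  exact ⟨s, fun y => congrArg Subtype.val (LinearMap.congr_fun hs y)⟩

theorem exists_retraction_ker {X Y : Type u} [AddCommGroup X] [Module A X]
    [AddCommGroup Y] [Module A Y] (f : X →ₗ[A] Y) [Module.Projective A (LinearMap.range f)] :
    ∃ p : X →ₗ[A] LinearMap.ker f, p.comp (LinearMap.ker f).subtype = LinearMap.id := by
  obtain ⟨s, hs⟩ := exists_section_rangeRestrict f
  have hmem : ∀ x : X, (LinearMap.id - s.comp f.rangeRestrict : X →ₗ[A] X) x ∈ LinearMap.ker f := fun x => by
    simp [hs]
  refine ⟨(LinearMap.id - s.comp f.rangeRestrict).codRestrict _ hmem,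
    LinearMap.ext fun x => Subtype.ext ?_⟩
  have hx : f.rangeRestrict x = 0 := Subtype.ext (LinearMap.mem_ker.1 x.2)
  simp [hx]

variable {C : ℤ → Type u} [∀ n, AddCommGroup (C n)] [∀ n, Module A (C n)]
  (D : ∀ n : ℤ, C (n + 1) →ₗ[A] C n)

theorem projective_range_of_exact [∀ n, Module.Projective A (C n)]
    (b : ℤ) (hb : ∀ n, n < b → Subsingleton (C n))
    (hD : ∀ n, LinearMap.ker (D n) = LinearMap.range (D (n + 1))) (n : ℤ) :
    Module.Projective A (LinearMap.range (D n)) := by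
  have hlt : ∀ m, m < b → Module.Projective A (LinearMap.range (D m)) := fun m hm => by
    have := hb m hm
    infer_instance
  obtain hn | hn := lt_or_ge n b
  · exact hlt n hn
  have hsucc : ∀ m, Module.Projective A (LinearMap.range (D m)) →
      Module.Projective A (LinearMap.range (D (m + 1))) := fun m hm => by
    obtain ⟨p, hp⟩ := exists_retraction_ker (D m)
    rw [← hD]
    exact Module.Projective.of_split _ p hp
  have key : ∀ m, b - 1 ≤ m → Module.Projective A (LinearMap.range (D m)) := fun m hm => by
    induction m, hm using Int.leInduction with
    | base => exact hlt _ (by lia)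
    | succ m _ ih => exact hsucc m ih
  exact key n (by lia)

/-- A bounded below exact complex of projective modules stays exact after applying
`Hom(-, M)`. -/
theorem exists_eq_comp_of_exact [∀ n, Module.Projective A (C n)]
    (b : ℤ) (hb : ∀ n, n < b → Subsingleton (C n))
    (hD : ∀ n, LinearMap.ker (D n) = LinearMap.range (D (n + 1)))
    {M : Type u} [AddCommGroup M] [Module A M] (n : ℤ) (φ : C (n + 1) →ₗ[A] M)
    (hφ : φ.comp (D (n + 1)) = 0) : ∃ φ₀ : C n →ₗ[A] M, φ = φ₀.comp (D n) := by
  obtain ⟨m, rfl⟩ : ∃ m, n = m + 1 := ⟨n - 1, by lia⟩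
  have := projective_range_of_exact D b hb hD
  obtain ⟨s, hs⟩ := exists_section_rangeRestrict (D (m + 1))
  obtain ⟨p, hp⟩ := exists_retraction_ker (D m)
  refine ⟨(φ.comp s).comp ((LinearEquiv.ofEq _ _ (hD m)).toLinearMap.comp p), ?_⟩
  ext x
  have hx : D (m + 1) x ∈ LinearMap.ker (D m) := hD m ▸ LinearMap.mem_range_self _ x
  have hpx : p (D (m + 1) x) = ⟨D (m + 1) x, hx⟩ := LinearMap.congr_fun hp ⟨_, hx⟩
  obtain ⟨y, hy⟩ : x - s ((D (m + 1)).rangeRestrict x) ∈ LinearMap.range (D (m + 1 + 1)) := by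
    rw [← hD, LinearMap.mem_ker, map_sub, hs]
    simp
  have h0 : φ (x - s ((D (m + 1)).rangeRestrict x)) = 0 := by
    rw [← hy]
    exact LinearMap.congr_fun hφ y
  rw [map_sub, sub_eq_zero] at h0
  simp only [LinearMap.comp_apply, hpx]
  exact h0

/-- The differential of the mapping cone of `g`, shifted by one. -/
def coneDifferential {P : ℤ → Type u} [∀ n, AddCommGroup (P n)] [∀ n, Module A (P n)]
    (dP : ∀ n : ℤ, P (n + 1) →ₗ[A] P n) (g : ∀ n : ℤ, C n →ₗ[A] P n) (n : ℤ) :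
    C (n + 1) × P (n + 1 + 1) →ₗ[A] C n × P (n + 1) :=
  ((-D n).comp (LinearMap.fst A _ _)).prod ((g (n + 1)).coprod (dP (n + 1)))

@[simp]
theorem coneDifferential_apply {P : ℤ → Type u} [∀ n, AddCommGroup (P n)]
    [∀ n, Module A (P n)] (dP : ∀ n : ℤ, P (n + 1) →ₗ[A] P n)
    (g : ∀ n : ℤ, C n →ₗ[A] P n) (n : ℤ) (x : C (n + 1) × P (n + 1 + 1)) :
    coneDifferential D dP g n x = (-D n x.1, g (n + 1) x.1 + dP (n + 1) x.2) := rfl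

/-- The mapping cone of a chain map between resolutions of the same module, compatible with
the augmentations, is exact. -/
theorem coneDifferential_exact {P : ℤ → Type u} [∀ n, AddCommGroup (P n)]
    [∀ n, Module A (P n)] (dP : ∀ n : ℤ, P (n + 1) →ₗ[A] P n)
    (g : ∀ n : ℤ, C n →ₗ[A] P n) (hg : ∀ n, (dP n).comp (g (n + 1)) = (g n).comp (D n))
    (hC : ∀ n : ℤ, n < 0 → Subsingleton (C n)) (hP : ∀ n : ℤ, n < 0 → Subsingleton (P n))
    {L : Type u} [AddCommGroup L] [Module A L] (εC : C 0 →ₗ[A] L) (εP : P 0 →ₗ[A] L)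
    (hε : εP.comp (g 0) = εC) (hεC : Function.Surjective εC)
    (hC0 : LinearMap.ker εC = LinearMap.range (D 0))
    (hP0 : LinearMap.ker εP = LinearMap.range (dP 0))
    (hCex : ∀ n : ℤ, 0 ≤ n → LinearMap.ker (D n) = LinearMap.range (D (n + 1)))
    (hPex : ∀ n : ℤ, 0 ≤ n → LinearMap.ker (dP n) = LinearMap.range (dP (n + 1)))
    (n : ℤ) : LinearMap.ker (coneDifferential D dP g n) =
      LinearMap.range (coneDifferential D dP g (n + 1)) := by
  have hg' : ∀ n x, dP n (g (n + 1) x) = g n (D n x) := fun n x =>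
    LinearMap.congr_fun (hg n) x
  have hε' : ∀ x, εP (g 0 x) = εC x := fun x => LinearMap.congr_fun hε x
  have hC0' : ∀ x, εC x = 0 ↔ ∃ y, D 0 y = x := fun x => SetLike.ext_iff.1 hC0 x
  have hP0' : ∀ x, εP x = 0 ↔ ∃ y, dP 0 y = x := fun x => SetLike.ext_iff.1 hP0 x
  have hDD : ∀ n x, D n (D (n + 1) x) = 0 := fun n x => by
    obtain hn | hn := lt_or_ge n 0
    · exact (hC n hn).elim _ _
    · exact (SetLike.ext_iff.1 (hCex n hn) _).2 ⟨x, rfl⟩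
  have hdd : ∀ n x, dP n (dP (n + 1) x) = 0 := fun n x => by
    obtain hn | hn := lt_or_ge n 0
    · exact (hP n hn).elim _ _
    · exact (SetLike.ext_iff.1 (hPex n hn) _).2 ⟨x, rfl⟩
  refine le_antisymm (fun x hx => ?_) ?_
  · obtain ⟨q, p⟩ := x
    rw [LinearMap.mem_ker, coneDifferential_apply, Prod.mk_eq_zero, neg_eq_zero] at hx
    obtain ⟨h₁, h₂⟩ := hx
    suffices ∃ q', D (n + 1) q' = q ∧ ∃ p', dP (n + 1 + 1) p' = p + g (n + 1 + 1) q' by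
      obtain ⟨q', rfl, p', hp'⟩ := this
      refine ⟨(-q', p'), ?_⟩
      simp [hp']
    obtain hn | hn := lt_or_ge n (-2)
    · have := hC (n + 1) (by lia)
      have := hP (n + 1 + 1) (by lia)
      exact ⟨0, Subsingleton.elim _ _, 0, Subsingleton.elim _ _⟩
    obtain rfl | hn := hn.eq_or_lt
    · have := hC (-2 + 1) (by lia)
      obtain ⟨y, hy⟩ := hεC (-εP p)
      refine ⟨y, Subsingleton.elim _ _, (hP0' _).1 ?_⟩
      rw [map_add]
      refine (congrArg (εP p + ·) ((hε' y).trans hy)).trans ?_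
      exact add_neg_cancel _
    have hcyc : ∃ q', D (n + 1) q' = q := by
      obtain rfl | hn : n = -1 ∨ 0 ≤ n := by lia
      · refine (hC0' q).1 ?_
        rw [← hε']
        refine (congrArg εP (eq_neg_of_add_eq_zero_left h₂)).trans ?_
        exact (map_neg εP _).trans (neg_eq_zero.2 ((hP0' _).2 ⟨p, rfl⟩))
      · exact (SetLike.ext_iff.1 (hCex n hn) _).1 h₁
    obtain ⟨q', rfl⟩ := hcyc
    refine ⟨q', rfl, (SetLike.ext_iff.1 (hPex (n + 1) (by lia)) _).1 ?_⟩
    rw [LinearMap.mem_ker, map_add, hg', ← h₂]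
    exact add_comm _ _
  · rintro _ ⟨x, rfl⟩
    simp [hDD, hdd, hg']

/-- A chain map between projective resolutions of the same module induces an isomorphism on
the cohomology of `Hom(-, M)`. -/
theorem comparison_of_resolutions [∀ n, Module.Projective A (C n)]
    {P : ℤ → Type u} [∀ n, AddCommGroup (P n)]
    [∀ n, Module A (P n)] [∀ n, Module.Projective A (P n)] (dP : ∀ n : ℤ, P (n + 1) →ₗ[A] P n)
    (g : ∀ n : ℤ, C n →ₗ[A] P n) (hg : ∀ n, (dP n).comp (g (n + 1)) = (g n).comp (D n))
    (hC : ∀ n : ℤ, n < 0 → Subsingleton (C n)) (hP : ∀ n : ℤ, n < 0 → Subsingleton (P n))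
    {L : Type u} [AddCommGroup L] [Module A L] (εC : C 0 →ₗ[A] L) (εP : P 0 →ₗ[A] L)
    (hε : εP.comp (g 0) = εC) (hεC : Function.Surjective εC)
    (hC0 : LinearMap.ker εC = LinearMap.range (D 0))
    (hP0 : LinearMap.ker εP = LinearMap.range (dP 0))
    (hCex : ∀ n : ℤ, 0 ≤ n → LinearMap.ker (D n) = LinearMap.range (D (n + 1)))
    (hPex : ∀ n : ℤ, 0 ≤ n → LinearMap.ker (dP n) = LinearMap.range (dP (n + 1)))
    (M : Type u) [AddCommGroup M] [Module A M] (n : ℤ) :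
    (∀ ψ : P (n + 1) →ₗ[A] M, ψ.comp (dP (n + 1)) = 0 → ∀ χ : C n →ₗ[A] M,
      ψ.comp (g (n + 1)) = χ.comp (D n) → ∃ ψ₀ : P n →ₗ[A] M, ψ = ψ₀.comp (dP n)) ∧
    (∀ χ' : C (n + 1) →ₗ[A] M, χ'.comp (D (n + 1)) = 0 →
      ∃ ψ : P (n + 1) →ₗ[A] M, ψ.comp (dP (n + 1)) = 0 ∧
        ∃ χ : C n →ₗ[A] M, ψ.comp (g (n + 1)) - χ' = χ.comp (D n)) := by
  have hacyc := exists_eq_comp_of_exact (C := fun k => C k × P (k + 1))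
    (coneDifferential D dP g) (-1)
    (fun k hk => by
      have := hC k (by lia)
      have := hP (k + 1) (by lia)
      infer_instance)
    (coneDifferential_exact D dP g hg hC hP εC εP hε hεC hC0 hP0 hCex hPex) (M := M)
  refine ⟨fun ψ hψ χ hχ => ?_, fun χ' hχ' => ?_⟩
  · obtain ⟨m, rfl⟩ : ∃ m, n = m + 1 := ⟨n - 1, by lia⟩
    obtain ⟨φ₀, hφ₀⟩ := hacyc m (χ.coprod ψ) (LinearMap.ext fun x => by
      have h₁ := LinearMap.congr_fun hχ x.1
      have h₂ := LinearMap.congr_fun hψ x.2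
      simp only [LinearMap.comp_apply, LinearMap.zero_apply] at h₁ h₂
      simp [h₁, h₂])
    refine ⟨φ₀.comp (LinearMap.inr A _ _), LinearMap.ext fun p => ?_⟩
    simpa using LinearMap.congr_fun hφ₀ (0, p)
  · obtain ⟨φ₀, hφ₀⟩ := hacyc n (χ'.comp (LinearMap.fst A _ _)) (LinearMap.ext fun x => by
      have h₁ := LinearMap.congr_fun hχ' x.1
      simp only [LinearMap.comp_apply, LinearMap.zero_apply] at h₁
      simp [h₁])
    refine ⟨φ₀.comp (LinearMap.inr A _ _), LinearMap.ext fun p => ?_,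
      φ₀.comp (LinearMap.inl A _ _), LinearMap.ext fun q => ?_⟩
    · simpa using (LinearMap.congr_fun hφ₀ (0, p)).symm
    · have h := LinearMap.congr_fun hφ₀ (q, 0)
      simp only [LinearMap.comp_apply, LinearMap.fst_apply, coneDifferential_apply, map_zero,
        add_zero] at h
      simp only [LinearMap.sub_apply, LinearMap.comp_apply, LinearMap.inl_apply,
        LinearMap.inr_apply]
      rw [h, ← map_sub]
      simp

end Acyclic

section Adjunction

variable {M : Type u} [AddCommGroup M] [Module A M] [Module A' M]

theorem extendHom_apply {s : ℕ} (ψ : (Fin s → A) →ₗ[A] M) (v : Fin s → A') :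
    extendHom s ψ v = ∑ j, v j • ψ (Pi.single j 1) := rfl

@[simp]
theorem extendHom_single {s : ℕ} (ψ : (Fin s → A) →ₗ[A] M) (j : Fin s) :
    extendHom s ψ (Pi.single j (1 : A')) = ψ (Pi.single j 1) := by
  simp [extendHom_apply, Pi.single_apply]

@[simp]
theorem extendHom_zero (s : ℕ) :
    (extendHom s (0 : (Fin s → A) →ₗ[A] M) : (Fin s → A') →ₗ[A'] M) = 0 := by
  refine LinearMap.ext fun v => ?_
  simp [extendHom_apply]

theorem extendHom_injective (s : ℕ) : Function.Injective
    (extendHom s : ((Fin s → A) →ₗ[A] M) → ((Fin s → A') →ₗ[A'] M)) := fun φ ψ h => by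
  refine LinearMap.ext fun v => ?_
  rw [← sum_smul_map_single φ, ← sum_smul_map_single ψ]
  refine Finset.sum_congr rfl fun j _ => ?_
  rw [← extendHom_single (A' := A') φ, h, extendHom_single]

theorem extendHom_scalarExtension {ρ : A →+* A'} (hAM : ∀ (a : A) (m : M), a • m = ρ a • m)
    {s : ℕ} (ψ : (Fin s → A) →ₗ[A] M) (x : A') (v : Fin s → A) :
    extendHom s ψ (scalarExtension ρ s x v) = x • ψ v := by
  rw [extendHom_apply, ← sum_smul_map_single ψ v, Finset.smul_sum]
  simp [hAM, mul_smul]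

theorem extendHom_comp {ρ : A →+* A'} (hAM : ∀ (a : A) (m : M), a • m = ρ a • m)
    {a b : ℕ} {f : (Fin a → A) →ₗ[A] (Fin b → A)} {f' : (Fin a → A') →ₗ[A'] (Fin b → A')}
    (hf : IsScalarExtension ρ f f') (ψ : (Fin b → A) →ₗ[A] M) :
    extendHom a (ψ.comp f) = (extendHom b ψ).comp f' := by
  refine LinearMap.ext fun v => ?_
  rw [← sum_scalarExtension_single ρ a v]
  simp only [map_sum]
  refine Finset.sum_congr rfl fun j _ => ?_
  rw [LinearMap.comp_apply, hf.map_scalarExtension, extendHom_scalarExtension hAM,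
    extendHom_scalarExtension hAM, LinearMap.comp_apply]

theorem exists_extendHom_eq {ρ : A →+* A'} (hAM : ∀ (a : A) (m : M), a • m = ρ a • m)
    {s : ℕ} (φ : (Fin s → A') →ₗ[A'] M) :
    ∃ ψ : (Fin s → A) →ₗ[A] M, extendHom s ψ = φ := by
  refine ⟨{ toFun := fun v => φ (scalarExtension ρ s 1 v)
            map_add' := by simp
            map_smul' := fun a v => ?_ }, LinearMap.ext fun v => ?_⟩
  · rw [RingHom.id_apply, hAM, ← map_smul]
    congr 1
    ext j
    simp
  · rw [extendHom_apply, ← sum_smul_map_single φ v]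
    refine Finset.sum_congr rfl fun j _ => congrArg (v j • φ ·) ?_
    ext i
    simp [Pi.single_apply, apply_ite ρ]

end Adjunction

/-- Let `A` be a left noetherian ring, `L` a finitely generated left
`A`-module with a resolution by finitely generated free modules `A^{r n}` (differentials
`d`, augmentation `ε`), and `ρ : A → A'` a ring homomorphism such that `A'` is flat as a
right `A`-module (right action `op a • x = x * ρ a`).  Let `M` be a left `A'`-module,
regarded as an `A`-module by restriction of scalars.  Encode `L' := A' ⊗_A L` by its
universal property (`tl`, with its left `A'`-structure), let `A'^{r •}` with the extended
differentials `d'` and augmentation `ε'` be the base-changed complex `A' ⊗_A A^{r •}`, let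
`Q` be any projective resolution of `L'` over `A'`, and let `g : Q → A'^{r •}` be a chain
map lifting the identity of `L'`.  Then for every `q ≥ 0` (written `q = n + 1`, `n ≥ -1`;
all modules vanish in negative degrees) the canonical map
`Ext^q_A(L, M) → Ext^q_{A'}(A' ⊗_A L, M)` — induced by the adjunction
`Hom_A(A^{r q}, M) ≅ Hom_{A'}(A'^{r q}, M)` followed by restriction along `g` — is an
isomorphism; elementwise: a cocycle `ψ` over `A` maps to a coboundary iff it is a
coboundary (injectivity), and every cocycle over `A'` agrees with the image of a cocycle
over `A` up to a coboundary (surjectivity). -/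
theorem ext_base_change_of_flat
    [IsNoetherianRing A] (ρ : A →+* A')
    (L : Type u) [AddCommGroup L] [Module A L] [Module.Finite A L]
    [Module Aᵐᵒᵖ A'] (hop : ∀ (a : A) (x : A'), op a • x = x * ρ a)
    (hflat : RightModuleFlat A A')
    (M : Type u) [AddCommGroup M] [Module A M] [Module A' M]
    (hAM : ∀ (a : A) (m : M), a • m = ρ a • m)
    -- a resolution of `L` by finitely generated free `A`-modules
    (r : ℤ → ℕ) (hrneg : ∀ n : ℤ, n < 0 → r n = 0)
    (d : ∀ n : ℤ, (Fin (r (n + 1)) → A) →ₗ[A] (Fin (r n) → A))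
    (ε : (Fin (r 0) → A) →ₗ[A] L)
    (hsurj : Function.Surjective ε)
    (hex0 : LinearMap.ker ε = LinearMap.range (d 0))
    (hexact : ∀ n : ℤ, 0 ≤ n → LinearMap.ker (d n) = LinearMap.range (d (n + 1)))
    -- the module `L' = A' ⊗_A L`, by its universal property
    (L' : Type u) [AddCommGroup L'] [Module A' L'] (tl : A' →+ L →+ L')
    (htl : IsBalancedTensor A A' L L' tl)
    (htl' : ∀ (c x : A') (l : L), tl (c * x) l = c • tl x l)
    -- the base-changed complex `A' ⊗_A A^{r •}`
    (d' : ∀ n : ℤ, (Fin (r (n + 1)) → A') →ₗ[A'] (Fin (r n) → A'))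
    (hd' : ∀ (n : ℤ) (v : Fin (r (n + 1)) → A') (i : Fin (r n)),
      d' n v i = ∑ j, v j * ρ (d n (Pi.single j 1) i))
    (ε' : (Fin (r 0) → A') →ₗ[A'] L')
    (hε' : ∀ v : Fin (r 0) → A', ε' v = ∑ j, tl (v j) (ε (Pi.single j 1)))
    -- a projective resolution `Q` of `L'` over `A'`
    (Q : ℤ → Type u) [∀ n, AddCommGroup (Q n)] [∀ n, Module A' (Q n)]
    [∀ n, Module.Projective A' (Q n)]
    (hQneg : ∀ n : ℤ, n < 0 → Subsingleton (Q n))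
    (dQ : ∀ n : ℤ, Q (n + 1) →ₗ[A'] Q n)
    (εQ : Q 0 →ₗ[A'] L')
    (hQsurj : Function.Surjective εQ)
    (hQex0 : LinearMap.ker εQ = LinearMap.range (dQ 0))
    (hQexact : ∀ n : ℤ, 0 ≤ n → LinearMap.ker (dQ n) = LinearMap.range (dQ (n + 1)))
    -- a comparison chain map `g : Q → A'^{r •}` lifting the identity of `L'`
    (g : ∀ n : ℤ, Q n →ₗ[A'] (Fin (r n) → A'))
    (hg0 : ε'.comp (g 0) = εQ)
    (hg : ∀ n : ℤ, (d' n).comp (g (n + 1)) = (g n).comp (dQ n))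
    (n : ℤ) :
    (∀ ψ : (Fin (r (n + 1)) → A) →ₗ[A] M, ψ.comp (d (n + 1)) = 0 →
      ((∃ χ : Q n →ₗ[A'] M, (extendHom (r (n + 1)) ψ).comp (g (n + 1)) = χ.comp (dQ n)) ↔
        (∃ ψ₀ : (Fin (r n) → A) →ₗ[A] M, ψ = ψ₀.comp (d n)))) ∧
    (∀ χ' : Q (n + 1) →ₗ[A'] M, χ'.comp (dQ (n + 1)) = 0 →
      ∃ ψ : (Fin (r (n + 1)) → A) →ₗ[A] M, ψ.comp (d (n + 1)) = 0 ∧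
        ∃ χ : Q n →ₗ[A'] M,
          (extendHom (r (n + 1)) ψ).comp (g (n + 1)) - χ' = χ.comp (dQ n)) := by
  have hP : ∀ k : ℤ, k < 0 → Subsingleton (Fin (r k) → A') := fun k hk => by
    rw [hrneg k hk]
    infer_instance
  have hext : ∀ k, IsScalarExtension ρ (d k) (d' k) := hd'
  have hP0 : LinearMap.ker ε' = LinearMap.range (d' 0) :=
    htl.ker_eq_range hop (hext 0) ε hsurj hex0 ε' hε'
  have hPex : ∀ k : ℤ, 0 ≤ k → LinearMap.ker (d' k) = LinearMap.range (d' (k + 1)) :=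
    fun k hk => hflat.ker_eq_range hop (hext (k + 1)) (hext k) (hexact k hk)
  have hcomp := comparison_of_resolutions dQ d' g hg hQneg hP εQ ε' hg0 hQsurj hQex0 hP0
    hQexact hPex M n
  refine ⟨fun ψ hψ => ⟨?_, ?_⟩, fun χ' hχ' => ?_⟩
  · rintro ⟨χ, hχ⟩
    obtain ⟨φ, hφ⟩ := hcomp.1 (extendHom _ ψ)
      (by rw [← extendHom_comp hAM (hext (n + 1)), hψ, extendHom_zero]) χ hχ
    obtain ⟨ψ₀, rfl⟩ := exists_extendHom_eq hAM φ
    exact ⟨ψ₀, extendHom_injective (A' := A') _ (hφ.trans (extendHom_comp hAM (hext n) ψ₀).symm)⟩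
  · rintro ⟨ψ₀, rfl⟩
    refine ⟨(extendHom _ ψ₀).comp (g n), ?_⟩
    rw [extendHom_comp hAM (hext n), LinearMap.comp_assoc, hg, LinearMap.comp_assoc]
  · obtain ⟨φ, hφ, hχ⟩ := hcomp.2 χ' hχ'
    obtain ⟨ψ, rfl⟩ := exists_extendHom_eq hAM φ
    refine ⟨ψ, extendHom_injective (A' := A') _ ?_, hχ⟩
    rw [extendHom_comp hAM (hext (n + 1)), hφ, extendHom_zero]
end

section
/- Let A be a ring, and let M and I be bounded-below cochain complexes of left A-modules such that every I^n is an injective module and Hom_A(M^n, I^{n−1}) = 0 for all n. Then the localization functor Q : C(Mod A) → D(Mod A) induces a bijection from the set of maps of cochain complexes M → I to the set of morphisms M → I in the derived category D(Mod A). -/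
open CategoryTheory CategoryTheory.Limits

universe w v u

/-- Homotopic maps of cochain complexes `M ⟶ I` are equal if there are no nonzero
morphisms `M.X n ⟶ I.X (n - 1)`. -/
lemma Homotopy.eq_of_forall_eq_zero {C : Type u} [Category.{v} C] [Preadditive C]
    {M I : CochainComplex C ℤ} (hvanish : ∀ (n : ℤ) (f : M.X n ⟶ I.X (n - 1)), f = 0)
    {f g : M ⟶ I} (h : Homotopy f g) : f = g := by
  have hh : h.hom = 0 := by
    ext i j
    by_cases hij : (ComplexShape.up ℤ).Rel j i
    · obtain rfl : j = i - 1 := eq_sub_of_add_eq hij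
      exact hvanish i _
    · exact h.zero i j hij
  ext n
  simp [h.comm n, hh]

/-- The localization functor `Q` is bijective on morphisms `M ⟶ I` into a K-injective complex
if there are no nonzero morphisms `M.X n ⟶ I.X (n - 1)`. -/
lemma DerivedCategory.Q_map_bijective_of_isKInjective {C : Type u} [Category.{v} C] [Abelian C]
    [HasDerivedCategory.{w} C] (M I : CochainComplex C ℤ) [I.IsKInjective]
    (hvanish : ∀ (n : ℤ) (f : M.X n ⟶ I.X (n - 1)), f = 0) :
    Function.Bijective (DerivedCategory.Q.map : (M ⟶ I) → _) := by
  have hquot : Function.Bijective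
      ((HomotopyCategory.quotient C (ComplexShape.up ℤ)).map : (M ⟶ I) → _) :=
    ⟨fun f g hfg ↦ (HomotopyCategory.homotopyOfEq f g hfg).eq_of_forall_eq_zero hvanish,
      Functor.map_surjective _⟩
  convert! (((quotientCompQhIso C).app M).homCongr ((quotientCompQhIso C).app I)).bijective.comp
    ((CochainComplex.IsKInjective.Qh_map_bijective _ I).comp hquot) using 1
  ext f
  simp

/-- Let `A` be a ring, and let `M` and `I` be bounded-below cochain complexes
of left `A`-modules such that every `I^n` is an injective module and `Hom_A(M^n, I^{n−1}) = 0`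
for all `n`.  Then the localization functor `Q : C(Mod A) → D(Mod A)` induces a bijection from
the set of maps of cochain complexes `M → I` to the set of morphisms `M → I` in the derived
category `D(Mod A)`. -/
theorem q_bijective_on_maps_into_injective_complex
    (A : Type u) [Ring A] [HasDerivedCategory.{w} (ModuleCat.{v} A)]
    (M I : CochainComplex (ModuleCat.{v} A) ℤ)
    (hM : ∃ N : ℤ, ∀ n < N, IsZero (M.X n))
    (hI : ∃ N : ℤ, ∀ n < N, IsZero (I.X n))
    (hinj : ∀ n : ℤ, Injective (I.X n))
    (hvanish : ∀ (n : ℤ) (f : M.X n ⟶ I.X (n - 1)), f = 0) :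
    Function.Bijective (fun f : M ⟶ I => DerivedCategory.Q.map f) := by
  obtain ⟨N, hN⟩ := hI
  have : I.IsStrictlyGE N := (I.isStrictlyGE_iff N).2 hN
  have : I.IsKInjective := CochainComplex.isKInjective_of_injective I N
  exact DerivedCategory.Q_map_bijective_of_isKInjective M I hvanish
end

section
/- Let A be a ring and L a left A-module admitting a resolution ⋯ → A^{r_2} → A^{r_1} → A^{r_0} → L → 0 in which every term is a finitely generated free module. Then for every q ≥ 0 the functor Ext^q_A(L, −) commutes with filtered colimits: for every filtered system {M_j} of left A-modules, the canonical map colim_j Ext^q_A(L, M_j) → Ext^q_A(L, colim_j M_j) is an isomorphism. -/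
universe u

namespace Module.DirectLimit

variable {A : Type*} [Ring A] {ι : Type*} [Preorder ι] [IsDirectedOrder ι] [Nonempty ι]
  [DecidableEq ι] {G : ι → Type*} [∀ i, AddCommGroup (G i)] [∀ i, Module A (G i)]
  {f : ∀ i j, i ≤ j → G i →ₗ[A] G j}

/-- Finitely many elements of a direct limit come from a common stage. -/
theorem exists_of_pi {κ : Type*} [Finite κ] (x : κ → Module.DirectLimit G f) :
    ∃ (i : ι) (y : κ → G i), ∀ k, of A ι G f i (y k) = x k := by
  choose s z hz using fun k => exists_of (x k)
  obtain ⟨i, hi⟩ := Finite.exists_le s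
  exact ⟨i, fun k => f (s k) i (hi k) (z k), fun k => by rw [of_f, hz]⟩

/-- A linear map from a finite free module to a direct limit factors through some stage. -/
theorem exists_of_comp_eq {κ : Type*} [Finite κ] (ψ : (κ → A) →ₗ[A] Module.DirectLimit G f) :
    ∃ (i : ι) (ψi : (κ → A) →ₗ[A] G i), (of A ι G f i).comp ψi = ψ := by
  classical
  obtain ⟨i, y, hy⟩ := exists_of_pi fun k => ψ (Pi.basisFun A κ k)
  refine ⟨i, (Pi.basisFun A κ).constr ℕ y, (Pi.basisFun A κ).ext fun k => ?_⟩
  rw [LinearMap.comp_apply, Module.Basis.constr_basis, hy]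

/-- A linear map from a finite free module to a stage that vanishes in the direct limit vanishes
at some later stage. -/
theorem exists_comp_eq_zero [DirectedSystem G (fun i j h => f i j h)] {κ : Type*} [Finite κ]
    {i : ι} (φ : (κ → A) →ₗ[A] G i) (h : (of A ι G f i).comp φ = 0) :
    ∃ (j : ι) (hij : i ≤ j), (f i j hij).comp φ = 0 := by
  choose s hs hz using fun k => of.zero_exact (LinearMap.congr_fun h (Pi.basisFun A κ k))
  obtain ⟨t, ht⟩ := Finite.exists_le s
  obtain ⟨j, hij, htj⟩ := exists_ge_ge i t
  refine ⟨j, hij, (Pi.basisFun A κ).ext fun k => ?_⟩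
  rw [LinearMap.comp_apply,
    ← DirectedSystem.map_map' f (hs k) ((ht k).trans htj), hz k, map_zero, LinearMap.zero_apply]

end Module.DirectLimit

/-- Let `A` be a ring and `L` a left `A`-module admitting a resolution
`⋯ → A^{r 1} → A^{r 0} → L → 0` by finitely generated free modules (indexed over `ℤ`, with
`r n = 0` for `n < 0`, so that `Ext^q` for `q ≥ 0` is computed at the spots `n + 1`,
`n ≥ -1`, of the complex `Hom_A(A^{r •}, −)`).  Then for every `q ≥ 0` the functor
`Ext^q_A(L, −)` commutes with filtered (here: directed) colimits: for every directed system
`{G i}` of left `A`-modules with colimit `Module.DirectLimit G f`, the canonical map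
`colim_i Ext^q_A(L, G i) → Ext^q_A(L, colim_i G i)` is an isomorphism.  This is expressed
elementwise: every cocycle into the colimit agrees, modulo coboundaries, with a cocycle
coming from some stage (surjectivity), and any stage cocycle that becomes a coboundary in
the colimit is already a coboundary at some later stage (injectivity). -/
theorem ext_of_finitely_resolved_commutes_with_directLimit
    (A : Type u) [Ring A] (L : Type u) [AddCommGroup L] [Module A L]
    (r : ℤ → ℕ) (hrneg : ∀ n : ℤ, n < 0 → r n = 0)
    (d : ∀ n : ℤ, (Fin (r (n + 1)) → A) →ₗ[A] (Fin (r n) → A))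
    (ε : (Fin (r 0) → A) →ₗ[A] L)
    (hsurj : Function.Surjective ε)
    (hex0 : LinearMap.ker ε = LinearMap.range (d 0))
    (hexact : ∀ n : ℤ, 0 ≤ n → LinearMap.ker (d n) = LinearMap.range (d (n + 1)))
    (ι : Type u) [Preorder ι] [IsDirected ι (· ≤ ·)] [Nonempty ι] [DecidableEq ι]
    (G : ι → Type u) [∀ i, AddCommGroup (G i)] [∀ i, Module A (G i)]
    (f : ∀ i j, i ≤ j → G i →ₗ[A] G j) [DirectedSystem G (fun i j h => f i j h)]
    (n : ℤ) :
    (∀ ψ : (Fin (r (n + 1)) → A) →ₗ[A] Module.DirectLimit G f,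
      ψ.comp (d (n + 1)) = 0 →
      ∃ (i : ι) (ψi : (Fin (r (n + 1)) → A) →ₗ[A] G i),
        ψi.comp (d (n + 1)) = 0 ∧
        ∃ χ : (Fin (r n) → A) →ₗ[A] Module.DirectLimit G f,
          ψ - (Module.DirectLimit.of A ι G f i).comp ψi = χ.comp (d n)) ∧
    (∀ (i : ι) (ψi : (Fin (r (n + 1)) → A) →ₗ[A] G i),
      ψi.comp (d (n + 1)) = 0 →
      (∃ χ : (Fin (r n) → A) →ₗ[A] Module.DirectLimit G f,
        (Module.DirectLimit.of A ι G f i).comp ψi = χ.comp (d n)) →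
      ∃ (j : ι) (hij : i ≤ j) (χj : (Fin (r n) → A) →ₗ[A] G j),
        (f i j hij).comp ψi = χj.comp (d n)) := by
  have of_comp_f {i j : ι} (hij : i ≤ j) :
      (Module.DirectLimit.of A ι G f j).comp (f i j hij) = Module.DirectLimit.of A ι G f i :=
    LinearMap.ext fun _ => Module.DirectLimit.of_f
  constructor
  · intro ψ hψ
    obtain ⟨i, φ, rfl⟩ := Module.DirectLimit.exists_of_comp_eq ψ
    obtain ⟨j, hij, hj⟩ := Module.DirectLimit.exists_comp_eq_zero (φ.comp (d (n + 1)))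
      (by rw [← LinearMap.comp_assoc, hψ])
    refine ⟨j, (f i j hij).comp φ, by rw [LinearMap.comp_assoc, hj], 0, ?_⟩
    rw [← LinearMap.comp_assoc, of_comp_f, sub_self, LinearMap.zero_comp]
  · rintro i ψi - ⟨χ, hχ⟩
    obtain ⟨k, χk, rfl⟩ := Module.DirectLimit.exists_of_comp_eq χ
    obtain ⟨l, hil, hkl⟩ := exists_ge_ge i k
    obtain ⟨j, hlj, hj⟩ := Module.DirectLimit.exists_comp_eq_zero
      ((f i l hil).comp ψi - ((f k l hkl).comp χk).comp (d n)) (by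
        rw [LinearMap.comp_sub, ← LinearMap.comp_assoc, ← LinearMap.comp_assoc,
          ← LinearMap.comp_assoc, of_comp_f, of_comp_f, hχ, sub_self])
    refine ⟨j, hil.trans hlj, (f k j (hkl.trans hlj)).comp χk, LinearMap.ext fun x => ?_⟩
    have hx := LinearMap.congr_fun hj x
    simpa only [LinearMap.comp_apply, LinearMap.sub_apply, map_sub, LinearMap.zero_apply,
      sub_eq_zero, DirectedSystem.map_map' f] using hx
end

section
/- Let K be a field, q ∈ K, and A := K⟨x, y⟩/(y x − q x y, y²), the quotient of the free associative K-algebra on x and y by the two-sided ideal generated by y x − q x y and y². For λ ∈ K let m_λ ⊆ A be the two-sided ideal generated by y and x − λ. Then for all λ ≠ μ in K, the A-bimodule (m_λ ∩ m_μ)/(m_λ m_μ) is nonzero if and only if μ = q λ; and when μ = q λ, it is one-dimensional as a K-vector space, spanned by the image of y. -/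
/-- The defining relations of `A = K⟨x,y⟩/(yx − q xy, y²)`. -/
inductive QPlaneRel (K : Type*) [Field K] (q : K) :
    FreeAlgebra K (Fin 2) → FreeAlgebra K (Fin 2) → Prop
  | comm : QPlaneRel K q (FreeAlgebra.ι K 1 * FreeAlgebra.ι K 0)
      (q • (FreeAlgebra.ι K 0 * FreeAlgebra.ι K 1))
  | sq : QPlaneRel K q (FreeAlgebra.ι K 1 * FreeAlgebra.ι K 1) 0

/-- `A = K⟨x,y⟩/(yx − q xy, y²)`, the quotient of the free associative algebra on two
generators by the two-sided ideal generated by `yx − q xy` and `y²`. -/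
abbrev QPlane (K : Type*) [Field K] (q : K) := RingQuot (QPlaneRel K q)

/-- The image of `x` in `A`. -/
noncomputable def QPlane.x (K : Type*) [Field K] (q : K) : QPlane K q :=
  RingQuot.mkAlgHom K (QPlaneRel K q) (FreeAlgebra.ι K 0)

/-- The image of `y` in `A`. -/
noncomputable def QPlane.y (K : Type*) [Field K] (q : K) : QPlane K q :=
  RingQuot.mkAlgHom K (QPlaneRel K q) (FreeAlgebra.ι K 1)

/-- The two-sided ideal generated by a set `s`, realized as a left ideal (it is the left
ideal generated by all `a * g * b` with `g ∈ s`). -/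
def twoSidedSpan {A : Type*} [Ring A] (s : Set A) : Ideal A :=
  Ideal.span {z | ∃ g ∈ s, ∃ a b : A, z = a * g * b}

/-- The two-sided ideal `m_λ = (y, x − λ)` of `A`. -/
noncomputable def QPlane.m (K : Type*) [Field K] (q : K) (lam : K) : Ideal (QPlane K q) :=
  twoSidedSpan {QPlane.y K q, QPlane.x K q - algebraMap K (QPlane K q) lam}

namespace QPlane

open Polynomial

variable {K : Type*} [Field K] {q : K}

theorem y_mul_x : y K q * x K q = q • (x K q * y K q) := by
  have h := RingQuot.mkAlgHom_rel K (QPlaneRel.comm (K := K) (q := q))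
  simpa only [x, y, map_mul, map_smul] using h

theorem y_mul_y : y K q * y K q = 0 := by
  have h := RingQuot.mkAlgHom_rel K (QPlaneRel.sq (K := K) (q := q))
  simpa only [y, map_mul, map_zero] using h

theorem induction_on {P : QPlane K q → Prop} (z : QPlane K q)
    (algebraMap : ∀ r : K, P (algebraMap K (QPlane K q) r)) (x : P (x K q)) (y : P (y K q))
    (add : ∀ a b, P a → P b → P (a + b)) (mul : ∀ a b, P a → P b → P (a * b)) : P z := by
  obtain ⟨w, rfl⟩ := RingQuot.mkAlgHom_surjective K (QPlaneRel K q) z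
  induction w using FreeAlgebra.induction with
  | grade0 r => simpa only [AlgHom.commutes] using algebraMap r
  | grade1 i => fin_cases i <;> assumption
  | mul a b ha hb => simpa only [map_mul] using mul _ _ ha hb
  | add a b ha hb => simpa only [map_add] using add _ _ ha hb

/-- The algebra homomorphism out of `QPlane K q` sending `x` to `a` and `y` to `b`. -/
noncomputable def lift {B : Type*} [Ring B] [Algebra K B] (a b : B) (hba : b * a = q • (a * b))
    (hb : b * b = 0) : QPlane K q →ₐ[K] B :=
  RingQuot.liftAlgHom K ⟨FreeAlgebra.lift K ![a, b], by
    rintro _ _ (_ | _) <;> simp [hba, hb]⟩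

section lift

variable {B : Type*} [Ring B] [Algebra K B] {a b : B} (hba : b * a = q • (a * b)) (hb : b * b = 0)

@[simp]
theorem lift_x : lift a b hba hb (x K q) = a := by
  simp [lift, x, RingQuot.liftAlgHom_mkAlgHom_apply]

@[simp]
theorem lift_y : lift a b hba hb (y K q) = b := by
  simp [lift, y, RingQuot.liftAlgHom_mkAlgHom_apply]

end lift

theorem y_mul_aeval_x (f : K[X]) :
    y K q * aeval (x K q) f = aeval (x K q) (f.comp (C q * X)) * y K q := by
  induction f using Polynomial.induction_on' with
  | add f g hf hg => simp only [map_add, add_comp, mul_add, add_mul, hf, hg]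
  | monomial n r =>
    have key : y K q * x K q ^ n = (q • x K q) ^ n * y K q :=
      SemiconjBy.pow_right (by rw [SemiconjBy, y_mul_x, smul_mul_assoc]) n
    simp only [aeval_monomial, monomial_comp, map_mul, map_pow, aeval_C, aeval_X,
      ← Algebra.smul_def, mul_smul_comm, smul_mul_assoc, key]

theorem exists_eq_aeval_add_aeval_mul_y (z : QPlane K q) :
    ∃ f g : K[X], z = aeval (x K q) f + aeval (x K q) g * y K q := by
  induction z using induction_on with
  | algebraMap r => exact ⟨C r, 0, by simp⟩
  | x => exact ⟨X, 0, by simp⟩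
  | y => exact ⟨0, 1, by simp⟩
  | add a b ha hb =>
    obtain ⟨f, g, rfl⟩ := ha
    obtain ⟨f', g', rfl⟩ := hb
    exact ⟨f + f', g + g', by simp only [map_add, add_mul]; abel⟩
  | mul a b ha hb =>
    obtain ⟨f, g, rfl⟩ := ha
    obtain ⟨f', g', rfl⟩ := hb
    refine ⟨f * f', f * g' + g * f'.comp (C q * X), ?_⟩
    have h : aeval (x K q) g * y K q * (aeval (x K q) g' * y K q) = 0 := by
      rw [mul_assoc, ← mul_assoc (y K q), y_mul_aeval_x, mul_assoc _ (y K q), y_mul_y, mul_zero,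
        mul_zero]
    rw [add_mul, mul_add, mul_add, h, mul_assoc _ (y K q), y_mul_aeval_x]
    simp only [map_add, map_mul, add_mul, mul_assoc, add_zero, add_assoc]

theorem y_mem_m (c : K) : y K q ∈ m K q c :=
  Ideal.subset_span ⟨_, Set.mem_insert _ _, 1, 1, by simp⟩

theorem x_sub_mem_m (c : K) : x K q - algebraMap K _ c ∈ m K q c :=
  Ideal.subset_span ⟨_, Set.mem_insert_of_mem _ rfl, 1, 1, by simp⟩

theorem m_le_ker {B : Type*} [Ring B] [Algebra K B] {c : K} (φ : QPlane K q →ₐ[K] B)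
    (hx : φ (x K q) = algebraMap K B c) (hy : φ (y K q) = 0) : m K q c ≤ RingHom.ker φ := by
  refine Ideal.span_le.2 ?_
  rintro _ ⟨g, rfl | rfl, a, b, rfl⟩ <;> simp [RingHom.mem_ker, hx, hy]

theorem eval_eq_zero_of_mem_m {c : K} {f g : K[X]}
    (h : aeval (x K q) f + aeval (x K q) g * y K q ∈ m K q c) : f.eval c = 0 := by
  have hz := m_le_ker (lift c (0 : K) (by simp) (by simp)) (by simp) (by simp) h
  simpa [RingHom.mem_ker, ← aeval_algHom_apply, coe_aeval_eq_eval] using hz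

theorem mul_mem_prodI {A : Type*} [Ring A] {I J : Ideal A} {a b : A} (ha : a ∈ I) (hb : b ∈ J) :
    a * b ∈ Ideal.prodI I J :=
  Ideal.subset_span ⟨a, ha, b, hb, rfl⟩

theorem exists_sub_smul_y_mem {lam mu : K} (hne : lam ≠ mu) {z : QPlane K q}
    (hz : z ∈ m K q lam ⊓ m K q mu) :
    ∃ k : K, z - k • y K q ∈ Ideal.prodI (m K q lam) (m K q mu) := by
  obtain ⟨f, g, rfl⟩ := exists_eq_aeval_add_aeval_mul_y z
  obtain ⟨h, hf⟩ : (X - C lam) * (X - C mu) ∣ f :=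
    (isCoprime_X_sub_C_of_isUnit_sub (sub_ne_zero.2 hne).isUnit).mul_dvd
      (dvd_iff_isRoot.2 (eval_eq_zero_of_mem_m hz.1))
      (dvd_iff_isRoot.2 (eval_eq_zero_of_mem_m hz.2))
  obtain ⟨g', hg⟩ := X_sub_C_dvd_sub_C_eval (a := lam) (p := g)
  have hf' : aeval (x K q) f ∈ Ideal.prodI (m K q lam) (m K q mu) := by
    rw [hf, mul_comm, map_mul, map_mul]
    refine Ideal.mul_mem_left _ _ (mul_mem_prodI ?_ ?_) <;>
      simpa only [map_sub, aeval_X, aeval_C] using x_sub_mem_m _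
  have hg' : aeval (x K q) (g - C (g.eval lam)) * y K q ∈
      Ideal.prodI (m K q lam) (m K q mu) := by
    rw [hg, mul_comm, map_mul, mul_assoc]
    refine Ideal.mul_mem_left _ _ (mul_mem_prodI ?_ (y_mem_m _))
    simpa only [map_sub, aeval_X, aeval_C] using x_sub_mem_m _
  refine ⟨g.eval lam, ?_⟩
  convert add_mem hf' hg' using 1
  rw [map_sub, aeval_C, sub_mul, ← Algebra.smul_def, add_sub_assoc]

theorem y_mem_prodI {lam mu : K} (h : mu ≠ q * lam) :
    y K q ∈ Ideal.prodI (m K q lam) (m K q mu) := by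
  have h₁ := mul_mem_prodI (x_sub_mem_m (q := q) lam) (y_mem_m mu)
  have h₂ := mul_mem_prodI (y_mem_m lam) (x_sub_mem_m (q := q) mu)
  have key : (q * lam - mu) • y K q ∈ Ideal.prodI (m K q lam) (m K q mu) := by
    convert sub_mem h₂ (Submodule.smul_of_tower_mem _ q h₁) using 1
    rw [mul_sub, sub_mul, y_mul_x, ← Algebra.commutes, smul_sub]
    simp only [Algebra.smul_def, map_sub, map_mul, sub_mul, mul_assoc]
    abel
  simpa [smul_smul, inv_mul_cancel₀ (sub_ne_zero.2 h.symm)] using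
    Submodule.smul_of_tower_mem _ (q * lam - mu)⁻¹ key

theorem y_notMem_prodI (lam : K) :
    y K q ∉ Ideal.prodI (m K q lam) (m K q (q * lam)) := by
  let φ : QPlane K q →ₐ[K] Matrix (Fin 2) (Fin 2) K :=
    lift !![lam, 0; 0, q * lam] !![0, 1; 0, 0]
      (by ext i j; fin_cases i <;> fin_cases j <;> simp)
      (by ext i j; fin_cases i <;> fin_cases j <;> simp)
  have hx : φ (x K q) = !![lam, 0; 0, q * lam] := lift_x _ _
  have hy : φ (y K q) = !![0, 1; 0, 0] := lift_y _ _
  have tri : ∀ z, φ z 1 0 = 0 := by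
    intro z
    induction z using induction_on with
    | algebraMap r => simp [AlgHom.commutes, Matrix.algebraMap_matrix_apply]
    | x => simp [hx]
    | y => simp [hy]
    | add a b ha hb => simp [ha, hb]
    | mul a b ha hb => simp [Matrix.mul_apply, ha, hb]
  have left : ∀ z ∈ m K q lam, φ z 0 0 = 0 := by
    intro z hz
    induction hz using Submodule.span_induction with
    | mem z hz =>
      obtain ⟨g, rfl | rfl, a, b, rfl⟩ := hz <;>
        simp [Matrix.mul_apply, Matrix.algebraMap_matrix_apply, hx, hy, tri]
    | zero => simp
    | add a b _ _ ha hb => simp [ha, hb]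
    | smul a b _ hb => simp [Matrix.mul_apply, hb, tri]
  have right : ∀ z ∈ m K q (q * lam), φ z 1 1 = 0 := by
    intro z hz
    induction hz using Submodule.span_induction with
    | mem z hz =>
      obtain ⟨g, rfl | rfl, a, b, rfl⟩ := hz <;>
        simp [Matrix.mul_apply, Matrix.algebraMap_matrix_apply, hx, hy, tri]
    | zero => simp
    | add a b _ _ ha hb => simp [ha, hb]
    | smul a b _ hb => simp [Matrix.mul_apply, hb, tri]
  have hle : Ideal.prodI (m K q lam) (m K q (q * lam)) ≤ RingHom.ker φ := by
    refine Ideal.span_le.2 ?_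
    rintro _ ⟨a, ha, b, hb, rfl⟩
    rw [SetLike.mem_coe, RingHom.mem_ker, map_mul]
    ext i j
    fin_cases i <;> fin_cases j <;>
      simp [Matrix.mul_apply, tri, left a ha, right b hb]
  intro h
  have hy0 : φ (y K q) = 0 := RingHom.mem_ker.1 (hle h)
  have h01 := congrArg (fun M : Matrix (Fin 2) (Fin 2) K => M 0 1) (hy.symm.trans hy0)
  simp at h01

end QPlane

/-- Let `K` be a field, `q ∈ K`, and `A := K⟨x,y⟩/(yx − qxy, y²)`.  For
`λ ∈ K` let `m_λ ⊆ A` be the two-sided ideal generated by `y` and `x − λ`.  Then for all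
`λ ≠ μ` in `K`, the `A`-bimodule `(m_λ ∩ m_μ)/(m_λ m_μ)` is nonzero if and only if
`μ = q λ`; and when `μ = q λ`, it is one-dimensional as a `K`-vector space, spanned by the
image of `y` (every element of `m_λ ∩ m_μ` is congruent modulo `m_λ m_μ` to a multiple
`k • y`, and `y ∉ m_λ m_μ`). -/
theorem qplane_linking_bimodule
    (K : Type*) [Field K] (q : K) (lam mu : K) (hne : lam ≠ mu) :
    ((¬ (QPlane.m K q lam ⊓ QPlane.m K q mu ≤
        Ideal.prodI (QPlane.m K q lam) (QPlane.m K q mu))) ↔ mu = q * lam) ∧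
    (mu = q * lam →
      (∀ z ∈ QPlane.m K q lam ⊓ QPlane.m K q mu,
        ∃ k : K, z - k • QPlane.y K q ∈ Ideal.prodI (QPlane.m K q lam) (QPlane.m K q mu)) ∧
      QPlane.y K q ∉ Ideal.prodI (QPlane.m K q lam) (QPlane.m K q mu)) := by
  have hlink : mu = q * lam →
      QPlane.y K q ∉ Ideal.prodI (QPlane.m K q lam) (QPlane.m K q mu) := by
    rintro rfl
    exact QPlane.y_notMem_prodI lam
  refine ⟨⟨fun h => ?_, fun h hle => ?_⟩, fun h => ⟨fun z hz => ?_, hlink h⟩⟩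
  · by_contra hmu
    refine h fun z hz => ?_
    obtain ⟨k, hk⟩ := QPlane.exists_sub_smul_y_mem hne hz
    simpa using add_mem hk (Submodule.smul_of_tower_mem _ k (QPlane.y_mem_prodI hmu))
  · exact hlink h (hle ⟨QPlane.y_mem_m lam, QPlane.y_mem_m mu⟩)
  · exact QPlane.exists_sub_smul_y_mem hne hz
end
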